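/- arXiv:1705.06630 — 14 statements merged into one kernel-verified Lean document; each statement's English description precedes it below -/
import Mathlib

section
/- Let U ⊆ ℝ² be open, let g = (g_{ij}) be a smooth symmetric 2×2-matrix valued function on U with det g ≠ 0 everywhere, and let f₀, f₁, f₂, f₃ be smooth real-valued functions on U. Let Γ^i_{jk} denote the Christoffel symbols of g and set a_{ij} = g_{ij}·|det g|^{−2/3}. Then the four identities f₀ = −Γ²₁₁, f₁ = Γ¹₁₁ − 2Γ²₁₂, f₂ = 2Γ¹₁₂ − Γ²₂₂, f₃ = Γ¹₂₂ hold on U if and only if the functions a₁₁, a₁₂, a₂₂ satisfy on U the linear first-order system: ∂ₓa₁₁ − (2/3)f₁a₁₁ + 2f₀a₁₂ = 0; ∂ᵧa₁₁ + 2∂ₓa₁₂ − (4/3)f₂a₁₁ + (2/3)f₁a₁₂ + 2f₀a₂₂ = 0; 2∂ᵧa₁₂ + ∂ₓa₂₂ − 2f₃a₁₁ − (2/3)f₂a₁₂ + (4/3)f₁a₂₂ = 0; ∂ᵧa₂₂ − 2f₃a₁₂ + (2/3)f₂a₂₂ = 0. -/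
open Real

/-- Partial derivative in direction `i` (0 = x, 1 = y) of a function on `ℝ × ℝ`. -/
noncomputable def pd (i : Fin 2) (f : ℝ × ℝ → ℝ) (p : ℝ × ℝ) : ℝ :=
  fderiv ℝ f p (if i = 0 then (1, 0) else (0, 1))

/-- Christoffel symbols `Γ^i_{jk}` of a 2×2-matrix valued metric on `ℝ × ℝ`. -/
noncomputable def christoffel (g : ℝ × ℝ → Matrix (Fin 2) (Fin 2) ℝ)
    (i j k : Fin 2) (p : ℝ × ℝ) : ℝ :=
  (1 / 2) * ∑ l : Fin 2, (g p)⁻¹ i l *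
    (pd j (fun q => g q l k) p + pd k (fun q => g q j l) p - pd l (fun q => g q j k) p)

/-- Liouville tensor `a_{ij} = g_{ij} · |det g|^(−2/3)`. -/
noncomputable def liouville (g : ℝ × ℝ → Matrix (Fin 2) (Fin 2) ℝ)
    (i j : Fin 2) (p : ℝ × ℝ) : ℝ :=
  g p i j * |(g p).det| ^ (-(2 : ℝ) / 3)

theorem hasDerivAt_absPow (r t : ℝ) (ht : t ≠ 0) :
    HasDerivAt (fun s : ℝ => |s| ^ r) (|t| ^ r * (r / t)) t := by
  have h1 : HasDerivAt (fun s : ℝ => Real.exp (Real.log s * r)) (Real.exp (Real.log t * r) * (t⁻¹ * r)) t :=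
    ((Real.hasDerivAt_log ht).mul_const r).exp
  have h2 : ∀ s : ℝ, s ≠ 0 → |s| ^ r = Real.exp (Real.log s * r) := by
    intro s hs
    rw [Real.rpow_def_of_pos (abs_pos.mpr hs), Real.log_abs]
  have h3 : HasDerivAt (fun s : ℝ => |s| ^ r) (Real.exp (Real.log t * r) * (t⁻¹ * r)) t := by
    refine h1.congr_of_eventuallyEq ?_
    filter_upwards [isOpen_ne.mem_nhds ht] with s hs
    exact h2 s hs
  rw [h2 t ht]
  convert h3 using 1
  ring

theorem pd_liouville (g : ℝ × ℝ → Matrix (Fin 2) (Fin 2) ℝ) (p : ℝ × ℝ)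
    (hd : ∀ i j : Fin 2, DifferentiableAt ℝ (fun q => g q i j) p)
    (hdet : (g p).det ≠ 0) (i j k : Fin 2) :
    pd i (liouville g j k) p = |(g p).det| ^ (-(2 : ℝ) / 3) *
      (pd i (fun q => g q j k) p - 2 / 3 * g p j k *
        (pd i (fun q => g q 0 0) p * g p 1 1 + g p 0 0 * pd i (fun q => g q 1 1) p
         - pd i (fun q => g q 0 1) p * g p 1 0 - g p 0 1 * pd i (fun q => g q 1 0) p)
        / (g p).det) := by
  have h0 := ((hd 0 0).hasFDerivAt.mul (hd 1 1).hasFDerivAt).sub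
      ((hd 0 1).hasFDerivAt.mul (hd 1 0).hasFDerivAt)
  have hfe : (fun q => (g q).det) =
      (fun q => g q 0 0) * (fun q => g q 1 1) - (fun q => g q 0 1) * (fun q => g q 1 0) := by
    funext q
    simp [Matrix.det_fin_two]
  rw [← hfe] at h0
  have h2 := (hasDerivAt_absPow (-(2 : ℝ) / 3) _ hdet).comp_hasFDerivAt p h0
  have h3 := (hd j k).hasFDerivAt.mul h2
  have h4 : fderiv ℝ (liouville g j k) p = _ := HasFDerivAt.fderiv h3
  unfold pd
  rw [h4]
  simp
  field_simp
  ring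

theorem pd_symm (U : Set (ℝ × ℝ)) (hU : IsOpen U)
    (g : ℝ × ℝ → Matrix (Fin 2) (Fin 2) ℝ)
    (hg_symm : ∀ p ∈ U, ∀ i j : Fin 2, g p i j = g p j i) (p : ℝ × ℝ) (hp : p ∈ U) (i : Fin 2) :
    pd i (fun q => g q 1 0) p = pd i (fun q => g q 0 1) p := by
  unfold pd
  have : (fun q => g q 1 0) =ᶠ[nhds p] (fun q => g q 0 1) := by
    filter_upwards [hU.mem_nhds hp] with q hq
    exact hg_symm q hq 1 0
  rw [this.fderiv_eq]

/-- The linear system has only the trivial homogeneous solution. -/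
theorem lin_inj (a b c h0 h1 h2 h3 : ℝ) (hd : a * c - b * b ≠ 0)
    (e1 : -(2 / 3) * h1 * a + 2 * h0 * b = 0)
    (e2 : -(4 / 3) * h2 * a + (2 / 3) * h1 * b + 2 * h0 * c = 0)
    (e3 : -2 * h3 * a - (2 / 3) * h2 * b + (4 / 3) * h1 * c = 0)
    (e4 : -2 * h3 * b + (2 / 3) * h2 * c = 0) : h0 = 0 ∧ h1 = 0 ∧ h2 = 0 ∧ h3 = 0 := by
  have hd2 : (a * c - b * b) ^ 2 ≠ 0 := pow_ne_zero _ hd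
  have z1 : h1 = 0 := by
    refine (mul_eq_zero.mp ?_).resolve_left hd2
    linear_combination (-3 / 2) * (2 * a * b * (b * e3 - a * e4) + (a * c + b * b) * (c * e1 - b * e2))
  have z2 : h2 = 0 := by
    refine (mul_eq_zero.mp ?_).resolve_left hd2
    linear_combination (-3 / 2) * (2 * b * c * (c * e1 - b * e2) + (a * c + b * b) * (b * e3 - a * e4))
  subst z1 z2
  refine ⟨?_, rfl, rfl, ?_⟩ <;> refine (mul_eq_zero.mp ?_).resolve_left hd
  · linear_combination (1 / 2) * (a * e2 - b * e1)
  · linear_combination (1 / 2) * (b * e4 - c * e3)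

theorem alg (a b c ax bx cx ay bY cy D f0 f1 f2 f3 F0 F1 F2 F3 : ℝ) (hd : a * c - b * b ≠ 0)
    (hD : D ≠ 0)
    (hF0 : F0 = -(1 / 2 * (-b / (a * c - b * b) * ax + a / (a * c - b * b) * (2 * bx - ay))))
    (hF1 : F1 = 1 / 2 * (c / (a * c - b * b) * ax - b / (a * c - b * b) * (2 * bx - ay))
      - 2 * (1 / 2 * (-b / (a * c - b * b) * ay + a / (a * c - b * b) * cx)))
    (hF2 : F2 = 2 * (1 / 2 * (c / (a * c - b * b) * ay - b / (a * c - b * b) * cx))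
      - 1 / 2 * (-b / (a * c - b * b) * (2 * bY - cx) + a / (a * c - b * b) * cy))
    (hF3 : F3 = 1 / 2 * (c / (a * c - b * b) * (2 * bY - cx) - b / (a * c - b * b) * cy)) :
    (f0 = F0 ∧ f1 = F1 ∧ f2 = F2 ∧ f3 = F3) ↔
    (D * (ax - 2 / 3 * a * (ax * c + a * cx - bx * b - b * bx) / (a * c - b * b))
        - (2 / 3) * f1 * (a * D) + 2 * f0 * (b * D) = 0 ∧
      D * (ay - 2 / 3 * a * (ay * c + a * cy - bY * b - b * bY) / (a * c - b * b))
        + 2 * (D * (bx - 2 / 3 * b * (ax * c + a * cx - bx * b - b * bx) / (a * c - b * b)))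
        - (4 / 3) * f2 * (a * D) + (2 / 3) * f1 * (b * D) + 2 * f0 * (c * D) = 0 ∧
      2 * (D * (bY - 2 / 3 * b * (ay * c + a * cy - bY * b - b * bY) / (a * c - b * b)))
        + D * (cx - 2 / 3 * c * (ax * c + a * cx - bx * b - b * bx) / (a * c - b * b))
        - 2 * f3 * (a * D) - (2 / 3) * f2 * (b * D) + (4 / 3) * f1 * (c * D) = 0 ∧
      D * (cy - 2 / 3 * c * (ay * c + a * cy - bY * b - b * bY) / (a * c - b * b))
        - 2 * f3 * (b * D) + (2 / 3) * f2 * (c * D) = 0) := by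
  have hd' : a * c - b ^ 2 ≠ 0 := by rwa [pow_two]
  have hd2 : c * a - b ^ 2 ≠ 0 := by rwa [mul_comm c a]
  have hd3 : -b ^ 2 + c * a ≠ 0 := by rwa [neg_add_eq_sub]
  have hd4 : -b ^ 2 + a * c ≠ 0 := by rwa [neg_add_eq_sub]
  have E1 : ax - 2 / 3 * a * (ax * c + a * cx - bx * b - b * bx) / (a * c - b * b)
      = 2 / 3 * F1 * a - 2 * F0 * b := by
    rw [hF0, hF1]; field_simp; ring
  have E2 : ay - 2 / 3 * a * (ay * c + a * cy - bY * b - b * bY) / (a * c - b * b)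
      + 2 * (bx - 2 / 3 * b * (ax * c + a * cx - bx * b - b * bx) / (a * c - b * b))
      = 4 / 3 * F2 * a - 2 / 3 * F1 * b - 2 * F0 * c := by
    rw [hF0, hF1, hF2]; field_simp; ring
  have E3 : 2 * (bY - 2 / 3 * b * (ay * c + a * cy - bY * b - b * bY) / (a * c - b * b))
      + (cx - 2 / 3 * c * (ax * c + a * cx - bx * b - b * bx) / (a * c - b * b))
      = 2 * F3 * a + 2 / 3 * F2 * b - 4 / 3 * F1 * c := by
    rw [hF1, hF2, hF3]; field_simp; ring
  have E4 : cy - 2 / 3 * c * (ay * c + a * cy - bY * b - b * bY) / (a * c - b * b)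
      = 2 * F3 * b - 2 / 3 * F2 * c := by
    rw [hF2, hF3]; field_simp; ring
  clear hF0 hF1 hF2 hF3
  constructor
  · rintro ⟨rfl, rfl, rfl, rfl⟩
    refine ⟨?_, ?_, ?_, ?_⟩
    · linear_combination D * E1
    · linear_combination D * E2
    · linear_combination D * E3
    · linear_combination D * E4
  · rintro ⟨e1, e2, e3, e4⟩
    have := lin_inj a b c (f0 - F0) (f1 - F1) (f2 - F2) (f3 - F3) hd
      (mul_left_cancel₀ hD (by linear_combination e1 - D * E1))
      (mul_left_cancel₀ hD (by linear_combination e2 - D * E2))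
      (mul_left_cancel₀ hD (by linear_combination e3 - D * E3))
      (mul_left_cancel₀ hD (by linear_combination e4 - D * E4))
    obtain ⟨h0, h1, h2, h3⟩ := this
    exact ⟨sub_eq_zero.mp h0, sub_eq_zero.mp h1, sub_eq_zero.mp h2, sub_eq_zero.mp h3⟩

/-- A projective connection `y'' = f₀ + f₁ y' + f₂ y'² + f₃ y'³` is the projective
connection of the metric `g` iff the Liouville tensor of `g` solves the linear
metrizability system. -/
theorem stmt_0 (U : Set (ℝ × ℝ)) (hU : IsOpen U)
    (g : ℝ × ℝ → Matrix (Fin 2) (Fin 2) ℝ)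
    (hg_smooth : ∀ i j : Fin 2, ContDiffOn ℝ (⊤ : ℕ∞) (fun p => g p i j) U)
    (hg_symm : ∀ p ∈ U, ∀ i j : Fin 2, g p i j = g p j i)
    (hg_det : ∀ p ∈ U, (g p).det ≠ 0)
    (f₀ f₁ f₂ f₃ : ℝ × ℝ → ℝ)
    (hf₀ : ContDiffOn ℝ (⊤ : ℕ∞) f₀ U) (hf₁ : ContDiffOn ℝ (⊤ : ℕ∞) f₁ U)
    (hf₂ : ContDiffOn ℝ (⊤ : ℕ∞) f₂ U) (hf₃ : ContDiffOn ℝ (⊤ : ℕ∞) f₃ U) :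
    (∀ p ∈ U,
        f₀ p = -(christoffel g 1 0 0 p) ∧
        f₁ p = christoffel g 0 0 0 p - 2 * christoffel g 1 0 1 p ∧
        f₂ p = 2 * christoffel g 0 0 1 p - christoffel g 1 1 1 p ∧
        f₃ p = christoffel g 0 1 1 p)
    ↔ (∀ p ∈ U,
        pd 0 (liouville g 0 0) p - (2 / 3) * f₁ p * liouville g 0 0 p
          + 2 * f₀ p * liouville g 0 1 p = 0 ∧
        pd 1 (liouville g 0 0) p + 2 * pd 0 (liouville g 0 1) p
          - (4 / 3) * f₂ p * liouville g 0 0 p + (2 / 3) * f₁ p * liouville g 0 1 p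
          + 2 * f₀ p * liouville g 1 1 p = 0 ∧
        2 * pd 1 (liouville g 0 1) p + pd 0 (liouville g 1 1) p
          - 2 * f₃ p * liouville g 0 0 p - (2 / 3) * f₂ p * liouville g 0 1 p
          + (4 / 3) * f₁ p * liouville g 1 1 p = 0 ∧
        pd 1 (liouville g 1 1) p - 2 * f₃ p * liouville g 0 1 p
          + (2 / 3) * f₂ p * liouville g 1 1 p = 0) := by
  refine forall₂_congr fun p hp => ?_
  have hd : ∀ i j : Fin 2, DifferentiableAt ℝ (fun q => g q i j) p := fun i j =>
    ((hg_smooth i j).contDiffAt (hU.mem_nhds hp)).differentiableAt (by simp)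
  have hdet := hg_det p hp
  have hD : |(g p).det| ^ (-(2 : ℝ) / 3) ≠ 0 :=
    (Real.rpow_pos_of_pos (abs_pos.mpr hdet) _).ne'
  have hs := hg_symm p hp 1 0
  have hps := pd_symm U hU g hg_symm p hp
  simp only [pd_liouville g p hd hdet]
  unfold liouville
  generalize |(g p).det| ^ (-(2 : ℝ) / 3) = D at hD
  have hdd : (g p).det = g p 0 0 * g p 1 1 - g p 0 1 * g p 0 1 := by
    rw [Matrix.det_fin_two, hs]
  rw [hdd] at hdet
  simp only [christoffel, Fin.sum_univ_two, Matrix.inv_def, Ring.inverse_eq_inv',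
    Matrix.adjugate_fin_two, hps, hdd, hs, Matrix.smul_apply, smul_eq_mul, Matrix.of_apply,
    Matrix.cons_val_zero, Matrix.cons_val_one, Matrix.cons_val']
  refine alg _ _ _ _ _ _ _ _ _ D _ _ _ _ _ _ _ _ hdet hD ?_ ?_ ?_ ?_
  all_goals ring
end

section
/- Let U ⊆ ℝ² be open, let a = (a_{ij}) be a smooth symmetric 2×2-matrix valued function on U with det a ≠ 0 everywhere, let w = (w¹, w²) be a smooth vector field on U, and let μ ∈ ℝ. Suppose a satisfies the weighted eigenvalue equation ∑_k w^k ∂_k a_{ij} + ∑_k a_{kj} ∂_i w^k + ∑_k a_{ik} ∂_j w^k − (4/3)(∂₁w¹ + ∂₂w²)·a_{ij} = μ·a_{ij} on U. Then the metric g defined by g_{ij} = a_{ij}/(det a)² satisfies (L_w g)_{ij} = −3μ·g_{ij} on U; that is, w is a homothetic vector field for g. -/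
open Real

/-- Component `k` of a vector field on `ℝ × ℝ`. -/
def wcomp (w : ℝ × ℝ → ℝ × ℝ) (k : Fin 2) (p : ℝ × ℝ) : ℝ :=
  if k = 0 then (w p).1 else (w p).2

/-- Components of the Lie derivative of a symmetric 2-tensor field `g` along `w`:
`(L_w g)_{ij} = ∑_k w^k ∂_k g_{ij} + ∑_k g_{kj} ∂_i w^k + ∑_k g_{ik} ∂_j w^k`. -/
noncomputable def lieD (w : ℝ × ℝ → ℝ × ℝ) (g : ℝ × ℝ → Matrix (Fin 2) (Fin 2) ℝ)
    (i j : Fin 2) (p : ℝ × ℝ) : ℝ :=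
  (∑ k : Fin 2, wcomp w k p * pd k (fun q => g q i j) p)
    + (∑ k : Fin 2, g p k j * pd i (wcomp w k) p)
    + (∑ k : Fin 2, g p i k * pd j (wcomp w k) p)

/-- Divergence `∂₁w¹ + ∂₂w²` of a vector field on `ℝ × ℝ`. -/
noncomputable def divergence (w : ℝ × ℝ → ℝ × ℝ) (p : ℝ × ℝ) : ℝ :=
  pd 0 (fun q => (w q).1) p + pd 1 (fun q => (w q).2) p

/-- The metric `g = a / (det a)²` associated to a Liouville tensor `a`. -/
noncomputable def metricOfLiouville (a : ℝ × ℝ → Matrix (Fin 2) (Fin 2) ℝ) (p : ℝ × ℝ) :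
    Matrix (Fin 2) (Fin 2) ℝ :=
  ((a p).det ^ 2)⁻¹ • a p

lemma pd_metric (a : ℝ × ℝ → Matrix (Fin 2) (Fin 2) ℝ) (p : ℝ × ℝ)
    (ha : ∀ i j : Fin 2, DifferentiableAt ℝ (fun q => a q i j) p)
    (hd : (a p).det ≠ 0) (i j k : Fin 2) :
    pd k (fun q => metricOfLiouville a q i j) p
      = ((a p).det ^ 2)⁻¹ * pd k (fun q => a q i j) p
        - 2 * ((a p).det ^ 3)⁻¹ * (pd k (fun q => a q 0 0) p * a p 1 1
          + a p 0 0 * pd k (fun q => a q 1 1) p - pd k (fun q => a q 0 1) p * a p 1 0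
          - a p 0 1 * pd k (fun q => a q 1 0) p) * a p i j := by
  have h := fun i j => (ha i j).hasFDerivAt
  have hD := ((h 0 0).mul (h 1 1)).sub ((h 0 1).mul (h 1 0))
  have hd' : a p 0 0 * a p 1 1 - a p 0 1 * a p 1 0 ≠ 0 := by
    rwa [Matrix.det_fin_two] at hd
  have hI := (hasDerivAt_inv (pow_ne_zero 2 hd')).comp_hasFDerivAt p (hD.pow 2)
  have hg := hI.mul (h i j)
  have e : (fun q => metricOfLiouville a q i j) = fun q =>
      ((a q 0 0 * a q 1 1 - a q 0 1 * a q 1 0) ^ 2)⁻¹ * a q i j := by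
    funext q
    simp [metricOfLiouville, Matrix.det_fin_two]
  have hf := hg.fderiv
  unfold pd
  rw [e, Matrix.det_fin_two]
  erw [hf]
  simp
  field_simp
  ring

/-- If a nondegenerate Liouville tensor `a` satisfies the weighted eigenvalue equation
`L_w a − (4/3)(div w)·a = μ·a`, then the corresponding metric `g = a/(det a)²`
satisfies `L_w g = −3μ·g`, i.e. `w` is homothetic for `g`. -/
theorem stmt_2 (U : Set (ℝ × ℝ)) (hU : IsOpen U)
    (a : ℝ × ℝ → Matrix (Fin 2) (Fin 2) ℝ)
    (ha_smooth : ∀ i j : Fin 2, ContDiffOn ℝ (⊤ : ℕ∞) (fun p => a p i j) U)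
    (ha_symm : ∀ p ∈ U, ∀ i j : Fin 2, a p i j = a p j i)
    (ha_det : ∀ p ∈ U, (a p).det ≠ 0)
    (w : ℝ × ℝ → ℝ × ℝ) (hw : ContDiffOn ℝ (⊤ : ℕ∞) w U)
    (μ : ℝ)
    (heig : ∀ p ∈ U, ∀ i j : Fin 2,
      lieD w a i j p - (4 / 3) * divergence w p * a p i j = μ * a p i j) :
    ∀ p ∈ U, ∀ i j : Fin 2,
      lieD w (metricOfLiouville a) i j p = -3 * μ * metricOfLiouville a p i j := by
  intro p hp i j
  have ha : ∀ i j : Fin 2, DifferentiableAt ℝ (fun q => a q i j) p := fun i j =>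
    ((ha_smooth i j).contDiffAt (hU.mem_nhds hp)).differentiableAt (by simp)
  have hd := ha_det p hp
  have e0 : (fun q => (w q).1) = wcomp w 0 := by funext q; simp [wcomp]
  have e1 : (fun q => (w q).2) = wcomp w 1 := by funext q; simp [wcomp]
  have H := heig p hp
  have hij := H i j
  have h00 := H 0 0
  have h01 := H 0 1
  have h10 := H 1 0
  have h11 := H 1 1
  clear H heig
  simp only [lieD, divergence, e0, e1, Fin.sum_univ_two, pd_metric a p ha hd] at *
  have hm : ∀ i j, metricOfLiouville a p i j = ((a p).det ^ 2)⁻¹ * a p i j := by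
    intro i j; simp [metricOfLiouville]
  simp only [hm]
  have hdet := Matrix.det_fin_two (a p)
  have hI3 : ((a p).det ^ 2)⁻¹ = ((a p).det ^ 3)⁻¹ * (a p).det := by field_simp
  rw [hI3]
  generalize ((a p).det ^ 3)⁻¹ = r
  rw [hdet]
  linear_combination r * (a p 0 0 * a p 1 1 - a p 0 1 * a p 1 0) * hij
    - 2 * r * a p i j * (a p 1 1 * h00 + a p 0 0 * h11 - a p 1 0 * h01 - a p 0 1 * h10)
end

section
/- Let k = (9/8)^{1/5} and define τ : ℝ² → ℝ² by τ(u,v) = ( (1/3)k²(eᵘ − eᵛ)², k(eᵘ + eᵛ) ). Let G be the symmetric matrix field of the metric (x + y²)dxdy, i.e. G(x,y) = [[0, (x+y²)/2], [(x+y²)/2, 0]], and let G'(u,v) = [[(e^{3u} − e^{3v})e^{2u}, 0], [0, −(e^{3u} − e^{3v})e^{2v}]] be the matrix of the metric (e^{3u} − e^{3v})(e^{2u}du² − e^{2v}dv²). Then for every (u,v) ∈ ℝ² one has Dτ(u,v)ᵀ · G(τ(u,v)) · Dτ(u,v) = G'(u,v); moreover τ has everywhere nonzero Jacobian determinant on {u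 ≠ v}, so τ is a local isometry from the metric (e^{3u} − e^{3v})(e^{2u}du² − e^{2v}dv²) on {u ≠ v} onto patches of the metric (x + y²)dxdy with x > 0. -/
open Real Matrix

/-- Jacobian matrix of a map `τ : ℝ × ℝ → ℝ × ℝ`. -/
noncomputable def jac (τ : ℝ × ℝ → ℝ × ℝ) (p : ℝ × ℝ) : Matrix (Fin 2) (Fin 2) ℝ :=
  Matrix.of fun i j => pd j (fun q => if i = 0 then (τ q).1 else (τ q).2) p

/-- The constant `k = (9/8)^(1/5)`. -/
noncomputable def kConst : ℝ := ((9 : ℝ) / 8) ^ ((1 : ℝ) / 5)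

/-- `τ(u,v) = ((1/3)k²(eᵘ − eᵛ)², k(eᵘ + eᵛ))`. -/
noncomputable def τ₃ (p : ℝ × ℝ) : ℝ × ℝ :=
  ((1 / 3) * kConst ^ 2 * (Real.exp p.1 - Real.exp p.2) ^ 2,
    kConst * (Real.exp p.1 + Real.exp p.2))

/-- Matrix of the metric `(x + y²) dxdy`. -/
noncomputable def Gtarget (p : ℝ × ℝ) : Matrix (Fin 2) (Fin 2) ℝ :=
  !![0, (p.1 + p.2 ^ 2) / 2; (p.1 + p.2 ^ 2) / 2, 0]

/-- Matrix of the metric `(e^{3u} − e^{3v})(e^{2u} du² − e^{2v} dv²)`. -/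
noncomputable def Gsource₃ (p : ℝ × ℝ) : Matrix (Fin 2) (Fin 2) ℝ :=
  !![(Real.exp (3 * p.1) - Real.exp (3 * p.2)) * Real.exp (2 * p.1), 0;
     0, -((Real.exp (3 * p.1) - Real.exp (3 * p.2)) * Real.exp (2 * p.2))]

theorem kConst_pos : 0 < kConst := by
  unfold kConst; positivity

theorem kConst_pow : kConst ^ 5 = 9 / 8 := by
  unfold kConst
  rw [← Real.rpow_natCast, ← Real.rpow_mul (by norm_num)]
  norm_num

theorem jac_τ₃ (p : ℝ × ℝ) : jac τ₃ p =
    !![(2 / 3) * kConst ^ 2 * (Real.exp p.1 - Real.exp p.2) * Real.exp p.1,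
       -((2 / 3) * kConst ^ 2 * (Real.exp p.1 - Real.exp p.2) * Real.exp p.2);
       kConst * Real.exp p.1, kConst * Real.exp p.2] := by
  have hu : HasFDerivAt (fun q : ℝ × ℝ => Real.exp q.1)
      (Real.exp p.1 • ContinuousLinearMap.fst ℝ ℝ ℝ) p := hasFDerivAt_fst.exp
  have hv : HasFDerivAt (fun q : ℝ × ℝ => Real.exp q.2)
      (Real.exp p.2 • ContinuousLinearMap.snd ℝ ℝ ℝ) p := hasFDerivAt_snd.exp
  have hs : HasFDerivAt (fun q : ℝ × ℝ => Real.exp q.1 - Real.exp q.2) _ p := hu.fun_sub hv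
  have h1 := ((HasFDerivAt.pow hs 2).const_mul ((1 / 3) * kConst ^ 2)).fderiv
  have h2 := ((hu.fun_add hv).const_mul kConst).fderiv
  ext i j
  fin_cases i <;> fin_cases j <;> simp [jac, pd, τ₃, -one_div] <;>
    first
      | (rw [h1]; simp; ring)
      | (rw [h2]; simp)

/-- `τ₃` pulls back the metric `(x + y²)dxdy` to `(e^{3u} − e^{3v})(e^{2u}du² − e^{2v}dv²)`,
has nonzero Jacobian determinant on `{u ≠ v}`, and maps `{u ≠ v}` into `{x > 0}`:
it is a local isometry between the two metrics. -/
theorem stmt_3 :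
    (∀ p : ℝ × ℝ, (jac τ₃ p)ᵀ * Gtarget (τ₃ p) * jac τ₃ p = Gsource₃ p) ∧
    (∀ p : ℝ × ℝ, p.1 ≠ p.2 → (jac τ₃ p).det ≠ 0) ∧
    (∀ p : ℝ × ℝ, p.1 ≠ p.2 → 0 < (τ₃ p).1) := by
  have hk := kConst_pos
  have hk5 := kConst_pow
  refine ⟨fun p => ?_, fun p hp => ?_, fun p hp => ?_⟩
  · have e3 : ∀ x : ℝ, Real.exp (3 * x) = Real.exp x ^ 3 := fun x => by
      rw [← Real.exp_nat_mul]; norm_num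
    have e2 : ∀ x : ℝ, Real.exp (2 * x) = Real.exp x ^ 2 := fun x => by
      rw [← Real.exp_nat_mul]; norm_num
    rw [jac_τ₃]
    simp only [Gtarget, Gsource₃, τ₃, e3, e2]
    generalize Real.exp p.1 = a
    generalize Real.exp p.2 = b
    ext i j
    fin_cases i <;> fin_cases j <;> simp [Matrix.mul_apply, Fin.sum_univ_two]
    · linear_combination (8 / 9) * (a ^ 3 - b ^ 3) * a ^ 2 * hk5
    · ring
    · ring
    · linear_combination -(8 / 9) * (a ^ 3 - b ^ 3) * b ^ 2 * hk5
  · have hne : Real.exp p.1 - Real.exp p.2 ≠ 0 :=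
      sub_ne_zero.mpr fun h => hp (Real.exp_injective h)
    have : (jac τ₃ p).det = (4 / 3) * kConst ^ 3 * (Real.exp p.1 - Real.exp p.2)
        * Real.exp p.1 * Real.exp p.2 := by
      rw [jac_τ₃, Matrix.det_fin_two_of]; ring
    rw [this]
    have := (Real.exp_pos p.1).ne'
    have := (Real.exp_pos p.2).ne'
    positivity
  · have hne : Real.exp p.1 - Real.exp p.2 ≠ 0 :=
      sub_ne_zero.mpr fun h => hp (Real.exp_injective h)
    simp only [τ₃]
    positivity
end

section
/- Define τ : ℝ² → ℝ² by τ(u,v) = ( (1/3)(−e^{−2u} + e^{2v−4u}), e^{v−2u} ). Let Ĝ be the symmetric matrix field of the metric −2((y²+x)/y³)dxdy + ((y²+x)²/y⁴)dy², i.e. Ĝ(x,y) = [[0, −(y²+x)/y³], [−(y²+x)/y³, (y²+x)²/y⁴]], defined on {y ≠ 0}. Then τ maps ℝ² into {y > 0}, its Jacobian determinant is nonzero at every point, and for every (u,v) ∈ ℝ² one has Dτ(u,v)ᵀ · Ĝ(τ(u,v)) · Dτ(u,v) = −(1/9)(e^{−2v} − 4e^{−2u}) · [[4, 0], [0, −1]].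 In other words, τ is a local isometry from the metric −(1/9)(e^{−2v} − 4e^{−2u})(4du² − dv²) onto patches of the metric −2((y²+x)/y³)dxdy + ((y²+x)²/y⁴)dy², which is projectively equivalent to (x+y²)dxdy. -/
open Real Matrix

/-- `τ(u,v) = ((1/3)(−e^{−2u} + e^{2v−4u}), e^{v−2u})`. -/
noncomputable def τ₅ (p : ℝ × ℝ) : ℝ × ℝ :=
  ((1 / 3) * (-Real.exp (-2 * p.1) + Real.exp (2 * p.2 - 4 * p.1)),
    Real.exp (p.2 - 2 * p.1))

/-- Matrix of the metric `−2((y²+x)/y³)dxdy + ((y²+x)²/y⁴)dy²` (on `{y ≠ 0}`). -/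
noncomputable def Ghat (p : ℝ × ℝ) : Matrix (Fin 2) (Fin 2) ℝ :=
  !![0, -((p.2 ^ 2 + p.1) / p.2 ^ 3);
     -((p.2 ^ 2 + p.1) / p.2 ^ 3), (p.2 ^ 2 + p.1) ^ 2 / p.2 ^ 4]

theorem jac_tau (p : ℝ × ℝ) : jac τ₅ p =
    !![(1/3) * (2 * Real.exp (-2 * p.1) - 4 * Real.exp (2 * p.2 - 4 * p.1)),
       (1/3) * (2 * Real.exp (2 * p.2 - 4 * p.1));
       -2 * Real.exp (p.2 - 2 * p.1), Real.exp (p.2 - 2 * p.1)] := by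
  have h1 : HasFDerivAt (fun q : ℝ × ℝ => q.1) (ContinuousLinearMap.fst ℝ ℝ ℝ) p := hasFDerivAt_fst
  have h2 : HasFDerivAt (fun q : ℝ × ℝ => q.2) (ContinuousLinearMap.snd ℝ ℝ ℝ) p := hasFDerivAt_snd
  have hx := (((h1.const_mul (-2)).exp.neg).add
    ((h2.const_mul 2).sub (h1.const_mul 4)).exp).const_mul (1/3 : ℝ)
  have hy := (h2.sub (h1.const_mul 2)).exp
  have ex : fderiv ℝ (fun q => (τ₅ q).1) p = _ := hx.fderiv
  have ey : fderiv ℝ (fun q => (τ₅ q).2) p = _ := hy.fderiv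
  ext i j
  fin_cases i <;> fin_cases j <;> simp [jac, pd, ex, ey] <;> ring

theorem exp_facts (p : ℝ × ℝ) : ∃ a b : ℝ, 0 < a ∧ 0 < b ∧ Real.exp (-2 * p.1) = a ∧
    Real.exp (2 * p.2 - 4 * p.1) = a ^ 2 * b ^ 2 ∧ Real.exp (p.2 - 2 * p.1) = a * b ∧
    Real.exp (-2 * p.2) = (b ^ 2)⁻¹ := by
  refine ⟨Real.exp (-2 * p.1), Real.exp p.2, Real.exp_pos _, Real.exp_pos _, rfl, ?_, ?_, ?_⟩
  · rw [← Real.exp_nat_mul, ← Real.exp_nat_mul, ← Real.exp_add]; congr 1; push_cast; ring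
  · rw [← Real.exp_add]; congr 1; ring
  · rw [← Real.exp_nat_mul, ← Real.exp_neg]; congr 1; push_cast; ring

/-- `τ₅` maps `ℝ²` into `{y > 0}`, has everywhere nonzero Jacobian determinant, and pulls
back the metric `−2((y²+x)/y³)dxdy + ((y²+x)²/y⁴)dy²` to
`−(1/9)(e^{−2v} − 4e^{−2u})(4du² − dv²)`: it is a local isometry between the two metrics. -/
theorem stmt_5 :
    (∀ p : ℝ × ℝ, 0 < (τ₅ p).2) ∧
    (∀ p : ℝ × ℝ, (jac τ₅ p).det ≠ 0) ∧
    (∀ p : ℝ × ℝ, (jac τ₅ p)ᵀ * Ghat (τ₅ p) * jac τ₅ p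
      = (-(1 / 9) * (Real.exp (-2 * p.2) - 4 * Real.exp (-2 * p.1))) •
          (!![4, 0; 0, -1] : Matrix (Fin 2) (Fin 2) ℝ)) := by
  refine ⟨fun p => Real.exp_pos _, fun p => ?_, fun p => ?_⟩
  · obtain ⟨a, b, ha, hb, h1, h2, h3, h4⟩ := exp_facts p
    rw [jac_tau, Matrix.det_fin_two_of, h1, h2, h3]
    have : (0:ℝ) < 2 / 3 * a ^ 2 * b := by positivity
    intro h
    nlinarith
  · obtain ⟨a, b, ha, hb, h1, h2, h3, h4⟩ := exp_facts p
    rw [jac_tau]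
    simp only [Ghat, τ₅]
    rw [h1, h2, h3, h4]
    ext i j
    fin_cases i <;> fin_cases j <;>
      simp [Matrix.mul_apply, Fin.sum_univ_two] <;> field_simp <;> ring
end

section
/- Fix ε ∈ {−1, 1} and let U = {(x,y) ∈ ℝ² : e^{4x} ≠ e^{4y} and e^{2x} + ε e^{2y} ≠ 0}. Consider on U the diagonal metric g with components E(x,y) = (e^{4x} − e^{4y})e^{2x}, F = 0, G(x,y) = ε(e^{4x} − e^{4y})e^{2y}, and the vector field v = (v¹, v²) with v¹(x,y) = e^{y−x}/(e^{2x} + ε e^{2y}) and v²(x,y) = ε e^{x−y}/(e^{2x} + ε e^{2y}). Then v is a Killing vector field of g on U; explicitly, the three Killing equations hold identically on U: v¹∂ₓE + v²∂ᵧE + 2E∂ₓv¹ = 0, E∂ᵧv¹ + G∂ₓv² = 0, and v¹∂ₓG + v²∂ᵧG + 2G∂ᵧv² = 0. -/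
open Real

/-- `E(x,y) = (e^{4x} − e^{4y}) e^{2x}`. -/
noncomputable def Ecoef (p : ℝ × ℝ) : ℝ :=
  (Real.exp (4 * p.1) - Real.exp (4 * p.2)) * Real.exp (2 * p.1)

/-- `G(x,y) = ε (e^{4x} − e^{4y}) e^{2y}`. -/
noncomputable def Gcoef (ε : ℝ) (p : ℝ × ℝ) : ℝ :=
  ε * (Real.exp (4 * p.1) - Real.exp (4 * p.2)) * Real.exp (2 * p.2)

/-- `v¹(x,y) = e^{y−x} / (e^{2x} + ε e^{2y})`. -/
noncomputable def vK₁ (ε : ℝ) (p : ℝ × ℝ) : ℝ :=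
  Real.exp (p.2 - p.1) / (Real.exp (2 * p.1) + ε * Real.exp (2 * p.2))

/-- `v²(x,y) = ε e^{x−y} / (e^{2x} + ε e^{2y})`. -/
noncomputable def vK₂ (ε : ℝ) (p : ℝ × ℝ) : ℝ :=
  ε * Real.exp (p.1 - p.2) / (Real.exp (2 * p.1) + ε * Real.exp (2 * p.2))

theorem pd_zero_eq {f : ℝ × ℝ → ℝ} {x y d : ℝ} (hf : DifferentiableAt ℝ f (x, y))
    (h : HasDerivAt (fun t => f (t, y)) d x) : pd 0 f (x, y) = d := by
  have h1 : HasDerivAt (fun t : ℝ => (t, y)) ((1 : ℝ), (0 : ℝ)) x :=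
    (hasDerivAt_id x).prodMk (hasDerivAt_const x y)
  have h2 := HasFDerivAt.comp_hasDerivAt (f := fun t : ℝ => (t, y)) x hf.hasFDerivAt h1
  simpa [pd] using h2.unique h

theorem pd_one_eq {f : ℝ × ℝ → ℝ} {x y d : ℝ} (hf : DifferentiableAt ℝ f (x, y))
    (h : HasDerivAt (fun t => f (x, t)) d y) : pd 1 f (x, y) = d := by
  have h1 : HasDerivAt (fun t : ℝ => (x, t)) ((0 : ℝ), (1 : ℝ)) y :=
    (hasDerivAt_const y x).prodMk (hasDerivAt_id y)
  have h2 := HasFDerivAt.comp_hasDerivAt (f := fun t : ℝ => (x, t)) y hf.hasFDerivAt h1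
  simpa [pd] using h2.unique h

theorem hasDerivAt_exp_mul (c x : ℝ) :
    HasDerivAt (fun t => Real.exp (c * t)) (c * Real.exp (c * x)) x := by
  have := ((hasDerivAt_id x).const_mul c).exp
  simpa [mul_comm] using this

theorem hasDerivAt_exp_sub_const (c x : ℝ) :
    HasDerivAt (fun t => Real.exp (t - c)) (Real.exp (x - c)) x := by
  simpa using ((hasDerivAt_id x).sub_const c).exp

theorem hasDerivAt_exp_const_sub (c x : ℝ) :
    HasDerivAt (fun t => Real.exp (c - t)) (-Real.exp (c - x)) x := by
  simpa using ((hasDerivAt_id x).const_sub c).exp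

/-- The vector field `v` is a Killing vector field of the diagonal metric
`g = (e^{4x} − e^{4y})(e^{2x}dx² + ε e^{2y}dy²)` on
`U = {e^{4x} ≠ e^{4y}, e^{2x} + ε e^{2y} ≠ 0}`: the three Killing equations hold on `U`. -/
theorem stmt_6 (ε : ℝ) (hε : ε = 1 ∨ ε = -1) :
    ∀ p : ℝ × ℝ,
      Real.exp (4 * p.1) ≠ Real.exp (4 * p.2) →
      Real.exp (2 * p.1) + ε * Real.exp (2 * p.2) ≠ 0 →
      (vK₁ ε p * pd 0 Ecoef p + vK₂ ε p * pd 1 Ecoef p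
          + 2 * Ecoef p * pd 0 (vK₁ ε) p = 0) ∧
      (Ecoef p * pd 1 (vK₁ ε) p + Gcoef ε p * pd 0 (vK₂ ε) p = 0) ∧
      (vK₁ ε p * pd 0 (Gcoef ε) p + vK₂ ε p * pd 1 (Gcoef ε) p
          + 2 * Gcoef ε p * pd 1 (vK₂ ε) p = 0) := by
  rintro ⟨x, y⟩ - hD
  simp only at hD
  have dE : DifferentiableAt ℝ Ecoef (x, y) := by unfold Ecoef; fun_prop
  have dG : DifferentiableAt ℝ (Gcoef ε) (x, y) := by unfold Gcoef; fun_prop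
  have d1 : DifferentiableAt ℝ (vK₁ ε) (x, y) := by
    unfold vK₁; fun_prop (disch := exact hD)
  have d2 : DifferentiableAt ℝ (vK₂ ε) (x, y) := by
    unfold vK₂; fun_prop (disch := exact hD)
  have Dx := (hasDerivAt_exp_mul 2 x).add_const (ε * Real.exp (2 * y))
  have Dy := ((hasDerivAt_exp_mul 2 y).const_mul ε).const_add (Real.exp (2 * x))
  have Px := (hasDerivAt_exp_mul 4 x).sub_const (Real.exp (4 * y))
  have Py := (hasDerivAt_exp_mul 4 y).const_sub (Real.exp (4 * x))
  rw [pd_zero_eq dE (Px.mul (hasDerivAt_exp_mul 2 x)),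
    pd_one_eq dE (Py.mul_const (Real.exp (2 * x))),
    pd_zero_eq dG ((Px.const_mul ε).mul_const (Real.exp (2 * y))),
    pd_one_eq dG ((Py.const_mul ε).mul (hasDerivAt_exp_mul 2 y)),
    pd_zero_eq d1 ((hasDerivAt_exp_const_sub y x).div Dx hD),
    pd_one_eq d1 ((hasDerivAt_exp_sub_const x y).div Dy hD),
    pd_zero_eq d2 (((hasDerivAt_exp_sub_const y x).const_mul ε).div Dx hD),
    pd_one_eq d2 (((hasDerivAt_exp_const_sub x y).const_mul ε).div Dy hD)]
  have e2 : ∀ z : ℝ, Real.exp (2 * z) = Real.exp z ^ 2 := fun z => by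
    rw [← Real.exp_nat_mul]; norm_num
  have e4 : ∀ z : ℝ, Real.exp (4 * z) = Real.exp z ^ 4 := fun z => by
    rw [← Real.exp_nat_mul]; norm_num
  have ha := Real.exp_ne_zero x
  have hb := Real.exp_ne_zero y
  simp only [vK₁, vK₂, Ecoef, Gcoef, e2, e4, Real.exp_sub] at hD ⊢
  generalize Real.exp x = a at *
  generalize Real.exp y = b at *
  rcases hε with rfl | rfl
  · refine ⟨?_, ?_, ?_⟩ <;> field_simp <;> ring
  · refine ⟨?_, ?_, ?_⟩ <;> field_simp <;> ring
end

section
/- Let λ ∈ ℝ with λ ≠ 0 and let n ∈ ℕ. Suppose real numbers a_{rm} and b_{rm} (for 0 ≤ r, m ≤ n) satisfy ∑_{r=0}^n ∑_{m=0}^n ( a_{rm}·cos(x)^r + b_{rm}·sin(x)·cos(x)^r )·e^{mλx} = 0 for every x ∈ ℝ. Then a_{rm} = 0 and b_{rm} = 0 for all 0 ≤ r, m ≤ n. Equivalently, the family of functions {cos(x)^r e^{mλx}, sin(x)cos(x)^r e^{mλx} : 0 ≤ r, m ≤ n} on ℝ is linearly independent over ℝ. -/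
open Real

theorem coeffs_zero (n : ℕ) (c : Fin (n + 1) → ℝ) (S : Set ℝ) (hS : S.Infinite)
    (h : ∀ t ∈ S, ∑ i : Fin (n + 1), c i * t ^ (i : ℕ) = 0) : ∀ i, c i = 0 := by
  have hp : (∑ i : Fin (n + 1), Polynomial.C (c i) * Polynomial.X ^ (i : ℕ)) = 0 := by
    apply Polynomial.eq_zero_of_infinite_isRoot
    refine hS.mono ?_
    intro t ht
    simpa [Polynomial.IsRoot, Polynomial.eval_finset_sum] using h t ht
  intro i
  have h2 := congrArg (fun p => Polynomial.coeff p (i : ℕ)) hp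
  simpa [Polynomial.finset_sum_coeff, Polynomial.coeff_C_mul, Polynomial.coeff_X_pow,
    Fin.val_inj] using h2

/-- For `λ ≠ 0`, the family of functions
`cos(x)^r e^{mλx}` and `sin(x) cos(x)^r e^{mλx}` (for `0 ≤ r, m ≤ n`) on ℝ is linearly
independent over ℝ: any vanishing linear combination has all coefficients zero. -/
theorem stmt_8 (lam : ℝ) (hlam : lam ≠ 0) (n : ℕ)
    (a b : Fin (n + 1) → Fin (n + 1) → ℝ)
    (h : ∀ x : ℝ,
      ∑ r : Fin (n + 1), ∑ m : Fin (n + 1),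
        (a r m * Real.cos x ^ (r : ℕ) + b r m * Real.sin x * Real.cos x ^ (r : ℕ))
          * Real.exp ((m : ℕ) * lam * x) = 0) :
    ∀ r m, a r m = 0 ∧ b r m = 0 := by
  have key : ∀ x : ℝ, ∀ m : Fin (n + 1),
      ∑ r : Fin (n + 1), (a r m * Real.cos x ^ (r : ℕ)
        + b r m * Real.sin x * Real.cos x ^ (r : ℕ)) = 0 := by
    intro x m
    have h1 := coeffs_zero n (fun m => (∑ r : Fin (n + 1), (a r m * Real.cos x ^ (r : ℕ)
        + b r m * Real.sin x * Real.cos x ^ (r : ℕ))) * Real.exp ((m : ℕ) * lam * x))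
      (Set.range fun k : ℕ => Real.exp (lam * (k * (2 * Real.pi)))) ?_ ?_ m
    · exact (mul_eq_zero.mp h1).resolve_right (Real.exp_pos _).ne'
    · apply Set.infinite_range_of_injective
      intro k l hkl
      have h3 := mul_left_cancel₀ hlam (Real.exp_injective hkl)
      exact_mod_cast mul_right_cancel₀ Real.two_pi_pos.ne' h3
    · rintro _ ⟨k, rfl⟩
      have h2 := h (x + k * (2 * Real.pi))
      rw [Finset.sum_comm] at h2
      rw [← h2]
      refine Finset.sum_congr rfl fun m _ => ?_
      rw [Finset.sum_mul, Finset.sum_mul]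
      refine Finset.sum_congr rfl fun r _ => ?_
      rw [Real.cos_add_nat_mul_two_pi, Real.sin_add_nat_mul_two_pi, mul_assoc,
        ← Real.exp_nat_mul, ← Real.exp_add]
      congr 2
      ring
  have split : ∀ x : ℝ, ∀ m : Fin (n + 1),
      ∑ r : Fin (n + 1), a r m * Real.cos x ^ (r : ℕ) = 0 ∧
      Real.sin x * ∑ r : Fin (n + 1), b r m * Real.cos x ^ (r : ℕ) = 0 := by
    intro x m
    have e : ∀ s : ℝ, ∑ r : Fin (n + 1), (a r m * Real.cos x ^ (r : ℕ)
        + b r m * s * Real.cos x ^ (r : ℕ)) = ∑ r : Fin (n + 1), a r m * Real.cos x ^ (r : ℕ)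
        + s * ∑ r : Fin (n + 1), b r m * Real.cos x ^ (r : ℕ) := by
      intro s
      rw [Finset.sum_add_distrib, Finset.mul_sum]
      congr 1
      exact Finset.sum_congr rfl fun r _ => by ring
    have h1 := key x m
    have h2 := key (-x) m
    rw [Real.cos_neg, Real.sin_neg] at h2
    rw [e] at h1 h2
    constructor <;> linarith
  have hS : (Set.Ioo (-1 : ℝ) 1).Infinite := Set.Ioo_infinite (by norm_num)
  intro r m
  constructor
  · refine coeffs_zero n (fun r => a r m) _ hS ?_ r
    intro t ht
    have h1 := (split (Real.arccos t) m).1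
    rwa [Real.cos_arccos ht.1.le ht.2.le] at h1
  · refine coeffs_zero n (fun r => b r m) _ hS ?_ r
    intro t ht
    have h1 := (split (Real.arccos t) m).2
    rw [Real.cos_arccos ht.1.le ht.2.le] at h1
    refine (mul_eq_zero.mp h1).resolve_left ?_
    rw [Real.sin_arccos]
    refine (Real.sqrt_pos.mpr ?_).ne'
    nlinarith [ht.1, ht.2]
end

section
/- Let λ ≥ 0 and let K, K' > 0, θ, θ', t ∈ ℝ. Assume additionally that if λ > 0 then 1 ≤ K < e^{2λπ} and 1 ≤ K' < e^{2λπ}. If K·e^{λ(t+θ)}·sin(θ+t) = K'·e^{λθ'}·sin(θ') and K·e^{λ(t+θ)}·cos(θ+t) = K'·e^{λθ'}·cos(θ'), then K' = K. -/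
open Real

/-- The parameter `K` of the parametrization `K e^{λθ}(sin θ · a₁ + cos θ · a₂)` is an
invariant of the flow orbits: if two parameter pairs `(K, θ)` and `(K', θ')` are related
by the time-`t` flow (acting by `e^{λt}` times rotation by `t`), then `K' = K`.
Here `λ ≥ 0`, and when `λ > 0` both `K, K'` are restricted to `[1, e^{2λπ})`. -/
theorem stmt_9 (lam K K' θ θ' t : ℝ)
    (hlam : 0 ≤ lam) (hK : 0 < K) (hK' : 0 < K')
    (hrange : 0 < lam →
      (1 ≤ K ∧ K < Real.exp (2 * lam * Real.pi) ∧
       1 ≤ K' ∧ K' < Real.exp (2 * lam * Real.pi)))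
    (h₁ : K * Real.exp (lam * (t + θ)) * Real.sin (θ + t)
        = K' * Real.exp (lam * θ') * Real.sin θ')
    (h₂ : K * Real.exp (lam * (t + θ)) * Real.cos (θ + t)
        = K' * Real.exp (lam * θ') * Real.cos θ') :
    K' = K := by
  have hA : 0 < K * Real.exp (lam * (t + θ)) := by positivity
  have hB : 0 < K' * Real.exp (lam * θ') := by positivity
  have hAB : K * Real.exp (lam * (t + θ)) = K' * Real.exp (lam * θ') := by
    generalize K * Real.exp (lam * (t + θ)) = A at *
    generalize K' * Real.exp (lam * θ') = B at *
    have e : A ^ 2 = B ^ 2 := by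
      calc A ^ 2 = A ^ 2 * (sin (θ + t) ^ 2 + cos (θ + t) ^ 2) := by
            rw [Real.sin_sq_add_cos_sq, mul_one]
        _ = (A * sin (θ + t)) ^ 2 + (A * cos (θ + t)) ^ 2 := by ring
        _ = B ^ 2 * (sin θ' ^ 2 + cos θ' ^ 2) := by rw [h₁, h₂]; ring
        _ = B ^ 2 := by rw [Real.sin_sq_add_cos_sq, mul_one]
    exact (pow_left_inj₀ hA.le hB.le two_ne_zero).mp e
  rw [hAB] at h₁ h₂
  have hs := mul_left_cancel₀ hB.ne' h₁
  have hc := mul_left_cancel₀ hB.ne' h₂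
  obtain ⟨n, hn⟩ := Real.Angle.angle_eq_iff_two_pi_dvd_sub.mp (Real.Angle.cos_sin_inj hc hs)
  have key : K * Real.exp (2 * lam * Real.pi * n) = K' := by
    have e : lam * (t + θ) = 2 * lam * Real.pi * n + lam * θ' := by
      linear_combination lam * hn
    rw [e, Real.exp_add, ← mul_assoc] at hAB
    exact mul_right_cancel₀ (Real.exp_pos _).ne' hAB
  rcases hlam.eq_or_lt with h0 | hpos
  · subst h0
    simpa using key.symm
  · obtain ⟨a, b, c, d⟩ := hrange hpos
    have hp : 0 < 2 * lam * Real.pi := by positivity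
    rcases lt_trichotomy n 0 with h | h | h
    · exfalso
      have h' : (n : ℝ) ≤ -1 := by exact_mod_cast Int.le_sub_one_of_lt h
      have : Real.exp (2 * lam * Real.pi * n) ≤ Real.exp (-(2 * lam * Real.pi)) :=
        Real.exp_le_exp.mpr (by nlinarith)
      have h3 : K' ≤ K * Real.exp (-(2 * lam * Real.pi)) := by
        rw [← key]; gcongr
      have h4 : K * Real.exp (-(2 * lam * Real.pi)) < 1 := by
        rw [Real.exp_neg, ← div_eq_mul_inv, div_lt_one (Real.exp_pos _)]; exact b
      linarith
    · subst h
      simpa using key.symm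
    · exfalso
      have h' : (1 : ℝ) ≤ n := by exact_mod_cast h
      have h2 : Real.exp (2 * lam * Real.pi) ≤ Real.exp (2 * lam * Real.pi * n) :=
        Real.exp_le_exp.mpr (by nlinarith)
      have h3 := Real.exp_pos (2 * lam * Real.pi * n)
      nlinarith
end

section
/- Let G₁, G₂, G₃ be the symmetric matrix fields of the three metrics g₁ = (y²+x)dxdy, g₂ = −2((y²+x)/y³)dxdy + ((y²+x)²/y⁴)dy², and g₃ = ((y²+x)/(3x−y²)⁶)·(9(y²+x)dx² − 4y(9x+y²)dxdy + 12x(y²+x)dy²), defined on D = {(x,y) ∈ ℝ² : y ≠ 0, x + y² ≠ 0, 3x − y² ≠ 0}. Let U ⊆ D be a nonempty connected open set and let τ : U → D be a smooth map with smooth inverse onto its image (a diffeomorphism onto its image). Suppose there exist nonzero constants μ₁, μ₂, μ₃ such that Dτ(p)ᵀ·G_i(τ(p))·Dτ(p) = μ_i·G_i(p) for all p ∈ U and i = 1, 2, 3. Then there exists k ∈ ℝ, k ≠ 0, such that τ(x,y) = (k²x, ky) for all (x,y) ∈ U. -/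
open Real Matrix

/-- Matrix of the metric `g₁ = (y² + x) dxdy`. -/
noncomputable def G₁ (p : ℝ × ℝ) : Matrix (Fin 2) (Fin 2) ℝ :=
  !![0, (p.2 ^ 2 + p.1) / 2; (p.2 ^ 2 + p.1) / 2, 0]

/-- Matrix of the metric `g₂ = −2((y²+x)/y³)dxdy + ((y²+x)²/y⁴)dy²`. -/
noncomputable def G₂ (p : ℝ × ℝ) : Matrix (Fin 2) (Fin 2) ℝ :=
  !![0, -((p.2 ^ 2 + p.1) / p.2 ^ 3);
     -((p.2 ^ 2 + p.1) / p.2 ^ 3), (p.2 ^ 2 + p.1) ^ 2 / p.2 ^ 4]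

/-- Matrix of the metric
`g₃ = ((y²+x)/(3x−y²)⁶)(9(y²+x)dx² − 4y(9x+y²)dxdy + 12x(y²+x)dy²)`. -/
noncomputable def G₃ (p : ℝ × ℝ) : Matrix (Fin 2) (Fin 2) ℝ :=
  ((p.2 ^ 2 + p.1) / (3 * p.1 - p.2 ^ 2) ^ 6) •
    !![9 * (p.2 ^ 2 + p.1), -(2 * p.2 * (9 * p.1 + p.2 ^ 2));
       -(2 * p.2 * (9 * p.1 + p.2 ^ 2)), 12 * p.1 * (p.2 ^ 2 + p.1)]

/-- The common domain of `g₁, g₂, g₃`. -/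
def Dom : Set (ℝ × ℝ) :=
  {p | p.2 ≠ 0 ∧ p.1 + p.2 ^ 2 ≠ 0 ∧ 3 * p.1 - p.2 ^ 2 ≠ 0}

/-- Any diffeomorphism onto its image that pulls back each of the three generators
`g₁, g₂, g₃` of the superintegrable projective class to a nonzero constant multiple of
itself is of the form `(x, y) ↦ (k²x, ky)`. -/
theorem stmt_10 (U : Set (ℝ × ℝ)) (hUopen : IsOpen U) (hUconn : IsConnected U)
    (hUD : U ⊆ Dom)
    (τ : ℝ × ℝ → ℝ × ℝ) (hτmaps : Set.MapsTo τ U Dom)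
    (hτsmooth : ContDiffOn ℝ (⊤ : ℕ∞) τ U) (hτinj : Set.InjOn τ U)
    (hτdet : ∀ p ∈ U, (jac τ p).det ≠ 0)
    (μ₁ μ₂ μ₃ : ℝ) (hμ₁ : μ₁ ≠ 0) (hμ₂ : μ₂ ≠ 0) (hμ₃ : μ₃ ≠ 0)
    (h₁ : ∀ p ∈ U, (jac τ p)ᵀ * G₁ (τ p) * jac τ p = μ₁ • G₁ p)
    (h₂ : ∀ p ∈ U, (jac τ p)ᵀ * G₂ (τ p) * jac τ p = μ₂ • G₂ p)
    (h₃ : ∀ p ∈ U, (jac τ p)ᵀ * G₃ (τ p) * jac τ p = μ₃ • G₃ p) :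
    ∃ k : ℝ, k ≠ 0 ∧ ∀ p ∈ U, τ p = (k ^ 2 * p.1, k * p.2) := by
  have key : ∀ p ∈ U, pd 0 (fun q => (τ q).2) p = 0 ∧ pd 1 (fun q => (τ q).1) p = 0 ∧
      μ₂ * (τ p).2 ^ 3 = μ₁ * p.2 ^ 3 ∧
      ((τ p).2 ^ 2 + (τ p).1) ^ 2 * pd 1 (fun q => (τ q).2) p ^ 2 * p.2 ^ 4
        = μ₂ * (p.2 ^ 2 + p.1) ^ 2 * (τ p).2 ^ 4 := by
    intro p hp
    have hD := hUD hp
    have hD' := hτmaps hp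
    have e1 := h₁ p hp
    have e2 := h₂ p hp
    have hdet := hτdet p hp
    simp only [Dom, Set.mem_setOf_eq] at hD hD'
    obtain ⟨hy, hs, -⟩ := hD
    obtain ⟨hY, hS, -⟩ := hD'
    rw [add_comm] at hs hS
    rw [Matrix.det_fin_two] at hdet
    have e100 := congrFun (congrFun e1 0) 0
    have e111 := congrFun (congrFun e1 1) 1
    have e101 := congrFun (congrFun e1 0) 1
    have e200 := congrFun (congrFun e2 0) 0
    have e201 := congrFun (congrFun e2 0) 1
    have e211 := congrFun (congrFun e2 1) 1
    clear e1 e2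
    simp [jac, G₁, G₂, Matrix.mul_apply, Fin.sum_univ_two] at hdet e100 e111 e101 e200 e201 e211
    generalize pd 0 (fun q => (τ q).1) p = a at *
    generalize pd 1 (fun q => (τ q).1) p = b at *
    generalize pd 0 (fun q => (τ q).2) p = c at *
    generalize pd 1 (fun q => (τ q).2) p = d at *
    generalize (τ p).1 = X at *
    generalize (τ p).2 = Y at *
    obtain ⟨x, y⟩ := p
    simp only at *
    have hac : a * c = 0 := by
      have : (Y ^ 2 + X) * (a * c) = 0 := by linarith
      exact (mul_eq_zero.mp this).resolve_left hS
    have hbd : b * d = 0 := by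
      have : (Y ^ 2 + X) * (b * d) = 0 := by linarith
      exact (mul_eq_zero.mp this).resolve_left hS
    have hc : c = 0 := by
      have : ((Y ^ 2 + X) ^ 2 / Y ^ 4) * c ^ 2 = 0 := by
        linear_combination e200 + 2 * ((Y ^ 2 + X) / Y ^ 3) * hac
      have h2 := (mul_eq_zero.mp this).resolve_left (by positivity)
      simpa using h2
    subst hc
    have hd : d ≠ 0 := by rintro rfl; simp at hdet
    have hb : b = 0 := (mul_eq_zero.mp hbd).resolve_right hd
    subst hb
    have f1 : (Y ^ 2 + X) * (a * d) = μ₁ * (y ^ 2 + x) := by linarith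
    refine ⟨rfl, rfl, ?_, ?_⟩
    · have g : (Y ^ 2 + X) / Y ^ 3 * (a * d) = μ₂ * ((y ^ 2 + x) / y ^ 3) := by
        linear_combination -e201
      field_simp at g
      have : (y ^ 2 + x) * (μ₂ * Y ^ 3) = (y ^ 2 + x) * (μ₁ * y ^ 3) := by
        linear_combination y ^ 3 * f1 - g
      exact mul_left_cancel₀ hs this
    · have g : (Y ^ 2 + X) ^ 2 / Y ^ 4 * d ^ 2 = μ₂ * ((y ^ 2 + x) ^ 2 / y ^ 4) := by
        linear_combination e211
      field_simp at g
      linear_combination g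
  obtain ⟨p₀, hp₀⟩ := hUconn.nonempty
  have hy₀ : p₀.2 ≠ 0 := (hUD hp₀).1
  have hY₀ : (τ p₀).2 ≠ 0 := (hτmaps hp₀).1
  obtain ⟨k, hk⟩ : ∃ k, k = (τ p₀).2 / p₀.2 := ⟨_, rfl⟩
  have hk0 : k ≠ 0 := by rw [hk]; exact div_ne_zero hY₀ hy₀
  have hk3 : μ₁ = μ₂ * k ^ 3 := by
    have := (key p₀ hp₀).2.2.1
    rw [hk]; field_simp; linarith
  have hY : ∀ p ∈ U, (τ p).2 = k * p.2 := by
    intro p hp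
    have := (key p hp).2.2.1
    have h3 : (τ p).2 ^ 3 = (k * p.2) ^ 3 := by
      apply mul_left_cancel₀ hμ₂
      rw [this, hk3]; ring
    exact (Odd.strictMono_pow (by decide : Odd 3)).injective h3
  have hd : ∀ p ∈ U, pd 1 (fun q => (τ q).2) p = k := by
    intro p hp
    have he : (fun q => (τ q).2) =ᶠ[nhds p] fun q => k * q.2 := by
      filter_upwards [hUopen.mem_nhds hp] with q hq using hY q hq
    have hf : HasFDerivAt (fun q : ℝ × ℝ => k * q.2) (k • ContinuousLinearMap.snd ℝ ℝ ℝ) p :=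
      hasFDerivAt_snd.const_mul k
    simp [pd, he.fderiv_eq, hf.fderiv]
  have hsq : ∀ p ∈ U, ((k * p.2) ^ 2 + (τ p).1) ^ 2 = μ₂ * k ^ 2 * (p.2 ^ 2 + p.1) ^ 2 := by
    intro p hp
    have h := (key p hp).2.2.2
    rw [hd p hp, hY p hp] at h
    have hy : p.2 ≠ 0 := (hUD hp).1
    have : (k ^ 2 * p.2 ^ 4) * ((k * p.2) ^ 2 + (τ p).1) ^ 2
        = (k ^ 2 * p.2 ^ 4) * (μ₂ * k ^ 2 * (p.2 ^ 2 + p.1) ^ 2) := by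
      linear_combination h
    exact mul_left_cancel₀ (by positivity) this
  refine ⟨k, hk0, fun p hp => ?_⟩
  have hy : p.2 ≠ 0 := (hUD hp).1
  have hs : p.1 + p.2 ^ 2 ≠ 0 := (hUD hp).2.1
  have hb := (key p hp).2.1
  have hτd : DifferentiableAt ℝ τ p :=
    (hτsmooth.contDiffAt (hUopen.mem_nhds hp)).differentiableAt (by simp)
  have hX : HasFDerivAt (fun q => (τ q).1) (fderiv ℝ (fun q => (τ q).1) p) p :=
    hτd.fst.hasFDerivAt
  have h2 : HasFDerivAt (fun q : ℝ × ℝ => q.2) (ContinuousLinearMap.snd ℝ ℝ ℝ) p := hasFDerivAt_snd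
  have h1 : HasFDerivAt (fun q : ℝ × ℝ => q.1) (ContinuousLinearMap.fst ℝ ℝ ℝ) p := hasFDerivAt_fst
  have hL := (((h2.const_mul k).pow 2).add hX).pow 2
  have hR := (((h2.pow 2).add h1).pow 2).const_mul (μ₂ * k ^ 2)
  have he : (fun q : ℝ × ℝ => ((k * q.2) ^ 2 + (τ q).1) ^ 2) =ᶠ[nhds p]
      fun q => μ₂ * k ^ 2 * (q.2 ^ 2 + q.1) ^ 2 := by
    filter_upwards [hUopen.mem_nhds hp] with q hq using hsq q hq
  have hE := congrArg (fun L => L ((0 : ℝ), (1 : ℝ))) (hL.unique (hR.congr_of_eventuallyEq he))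
  simp only [pd] at hb
  simp at hE hb
  rw [hb] at hE
  have hS : (k * p.2) ^ 2 + (τ p).1 = μ₂ * (p.2 ^ 2 + p.1) := by
    apply mul_left_cancel₀ (show 4 * k ^ 2 * p.2 ≠ 0 by positivity)
    linear_combination hE
  have hm : μ₂ = k ^ 2 := by
    have h := hsq p hp
    rw [hS] at h
    rw [add_comm] at hs
    apply mul_left_cancel₀ (show μ₂ * (p.2 ^ 2 + p.1) ^ 2 ≠ 0 by positivity)
    linear_combination h
  ext
  · simp only
    rw [hm] at hS
    linear_combination hS
  · exact hY p hp
end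

section
/- Let y₀ > 3 and c ∈ ℝ, and define Y₁ : (3, ∞) → ℝ by Y₁(y) = (y − 3)·( c + ∫_{y₀}^{y} e^{3/(2s)}·√s·(s − 3)^{−2} ds ). Then Y₁ is smooth and satisfies on (3, ∞) the second-order linear ODE y²·Y₁''(y) − (1/2)(y − 3)·Y₁'(y) + (1/2)·Y₁(y) = 0. -/
open Real

/-- `Y₁(y) = (y − 3)(c + ∫_{y₀}^{y} e^{3/(2s)} √s (s − 3)⁻² ds)`. -/
noncomputable def Y₁ (y₀ c : ℝ) (y : ℝ) : ℝ :=
  (y - 3) * (c + ∫ s in y₀..y, Real.exp (3 / (2 * s)) * Real.sqrt s / (s - 3) ^ 2)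

/-- the integrand -/
noncomputable def fInt (s : ℝ) : ℝ := Real.exp (3 / (2 * s)) * Real.sqrt s / (s - 3) ^ 2

lemma fInt_smooth : ContDiffOn ℝ (⊤ : ℕ∞) fInt (Set.Ioi 3) := by
  intro s hs
  have hs : (3:ℝ) < s := hs
  have h1 : (2 * s) ≠ 0 := by linarith
  have h2 : s ≠ 0 := by linarith
  have h3 : (s - 3) ^ 2 ≠ 0 := pow_ne_zero 2 (by linarith)
  apply ContDiffAt.contDiffWithinAt
  unfold fInt
  apply ContDiffAt.div
  · exact ((contDiffAt_const.div (contDiffAt_const.mul contDiffAt_id) h1).exp).mul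
      (Real.contDiffAt_sqrt h2)
  · exact (contDiffAt_id.sub contDiffAt_const).pow 2
  · exact h3

lemma fInt_deriv (s : ℝ) (hs : 3 < s) : HasDerivAt fInt
    (fInt s * (-3 / (2 * s ^ 2) + 1 / (2 * s) - 2 / (s - 3))) s := by
  have h1 : (2 * s) ≠ 0 := by linarith
  have h2 : s ≠ 0 := by linarith
  have h4 : s - 3 ≠ 0 := by linarith
  have h3 : (s - 3) ^ 2 ≠ 0 := pow_ne_zero 2 h4
  have hq : Real.sqrt s ≠ 0 := (Real.sqrt_pos.2 (by linarith)).ne'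
  have hqq : Real.sqrt s ^ 2 = s := Real.sq_sqrt (by linarith)
  have a := (((hasDerivAt_const s (3:ℝ)).div ((hasDerivAt_id s).const_mul 2) h1).exp.mul
    (Real.hasDerivAt_sqrt h2)).div (((hasDerivAt_id s).sub_const 3).pow 2) h3
  refine HasDerivAt.congr_deriv (f := fInt) a ?_
  have key : 1 / (2 * Real.sqrt s) = Real.sqrt s * (1 / (2 * s)) := by
    field_simp
    exact hqq.symm
  simp only [key, fInt, Pi.div_apply, Pi.mul_apply, Pi.pow_apply, id]
  generalize Real.exp _ = E
  generalize Real.sqrt s = q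
  field_simp
  ring

lemma int_deriv (y₀ y : ℝ) (hy₀ : 3 < y₀) (hy : 3 < y) :
    HasDerivAt (fun y => ∫ s in y₀..y, fInt s) (fInt y) y := by
  have hc := fInt_smooth.continuousOn
  apply intervalIntegral.integral_hasDerivAt_right
  · apply ContinuousOn.intervalIntegrable
    apply hc.mono
    intro x hx
    exact lt_of_lt_of_le (lt_min hy₀ hy) hx.1
  · exact hc.stronglyMeasurableAtFilter isOpen_Ioi y hy
  · exact hc.continuousAt (Ioi_mem_nhds hy)

lemma Y_deriv (y₀ c y : ℝ) (hy₀ : 3 < y₀) (hy : 3 < y) :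
    HasDerivAt (Y₁ y₀ c) ((c + ∫ s in y₀..y, fInt s) + (y - 3) * fInt y) y := by
  have := ((hasDerivAt_id y).sub_const 3).mul ((int_deriv y₀ y hy₀ hy).const_add c)
  refine HasDerivAt.congr_deriv (f := Y₁ y₀ c) this ?_
  simp

/-- The function `Y₁` is smooth on `(3, ∞)` and satisfies there the second-order ODE
`y² Y₁'' − (1/2)(y − 3) Y₁' + (1/2) Y₁ = 0`. -/
theorem stmt_11 (y₀ : ℝ) (hy₀ : 3 < y₀) (c : ℝ) :
    ContDiffOn ℝ (⊤ : ℕ∞) (Y₁ y₀ c) (Set.Ioi 3) ∧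
    ∀ y : ℝ, 3 < y →
      y ^ 2 * deriv (deriv (Y₁ y₀ c)) y - (1 / 2) * (y - 3) * deriv (Y₁ y₀ c) y
        + (1 / 2) * Y₁ y₀ c y = 0 := by
  constructor
  · have hI : ContDiffOn ℝ (⊤ : ℕ∞) (fun y => ∫ s in y₀..y, fInt s) (Set.Ioi 3) := by
      rw [contDiffOn_infty_iff_deriv_of_isOpen isOpen_Ioi]
      refine ⟨fun y hy => (int_deriv y₀ y hy₀ hy).differentiableAt.differentiableWithinAt, ?_⟩
      exact fInt_smooth.congr fun y hy => (int_deriv y₀ y hy₀ hy).deriv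
    exact (contDiffOn_id.sub contDiffOn_const).mul (contDiffOn_const.add hI)
  · intro y hy
    have h2 : deriv (deriv (Y₁ y₀ c)) y = 2 * fInt y + (y - 3) *
        (fInt y * (-3 / (2 * y ^ 2) + 1 / (2 * y) - 2 / (y - 3))) := by
      have he : deriv (Y₁ y₀ c) =ᶠ[nhds y]
          fun y => (c + ∫ s in y₀..y, fInt s) + (y - 3) * fInt y := by
        filter_upwards [Ioi_mem_nhds hy] with z hz
        exact (Y_deriv y₀ c z hy₀ hz).deriv
      rw [he.deriv_eq]
      have := ((int_deriv y₀ y hy₀ hy).const_add c).add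
        (((hasDerivAt_id y).sub_const 3).mul (fInt_deriv y hy))
      refine (HasDerivAt.congr_deriv (f := fun y => (c + ∫ s in y₀..y, fInt s) +
        (y - 3) * fInt y) this ?_).deriv
      simp only [id]
      ring
    have hY : Y₁ y₀ c y = (y - 3) * (c + ∫ s in y₀..y, fInt s) := rfl
    rw [h2, (Y_deriv y₀ c y hy₀ hy).deriv, hY]
    have h0 : y ≠ 0 := by linarith
    have h4 : y - 3 ≠ 0 := by linarith
    generalize (∫ s in y₀..y, fInt s) = J
    generalize fInt y = F
    field_simp
    ring
end

section
/- Let λ > 0 and let c₁, c₂ ∈ ℝ∖{0} and d₂ ∈ ℝ. Suppose that for every y ∈ ℝ one has c₁·e^{(3/2)λ·arctan(y)}·(y² + 1)^{−3/4} = c₂·e^{(3/2)λ·arctan(c₂y + d₂)}·((c₂y + d₂)² + 1)^{−3/4}. Then d₂ = 0, c₂ = 1 and c₁ = 1. -/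
open Real

lemma aux_deriv (a y : ℝ) :
    HasDerivAt (fun y : ℝ => Real.exp (a * Real.arctan y) * (y ^ 2 + 1) ^ (-(3 : ℝ) / 4))
      (Real.exp (a * Real.arctan y) * (y ^ 2 + 1) ^ (-(3 : ℝ) / 4)
        * ((a - 3 / 2 * y) / (y ^ 2 + 1))) y := by
  have hp : 0 < y ^ 2 + 1 := by positivity
  have h1 := ((Real.hasDerivAt_arctan y).const_mul a).exp
  have h2 : HasDerivAt (fun y : ℝ => y ^ 2 + 1) (2 * y) y := by
    simpa using (hasDerivAt_pow 2 y).add_const 1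
  have h3 := h2.rpow_const (p := -(3 : ℝ) / 4) (Or.inl hp.ne')
  refine (h1.mul h3).congr_deriv ?_
  rw [Real.rpow_sub_one hp.ne']
  have : 1 + y ^ 2 ≠ 0 := by positivity
  rw [add_comm 1 (y ^ 2)]
  field_simp
  ring

/-- The functional equation
`c₁ e^{(3/2)λ arctan y}(y²+1)^{−3/4} = c₂ e^{(3/2)λ arctan(c₂y+d₂)}((c₂y+d₂)²+1)^{−3/4}`
(for all real `y`, with `λ > 0` and `c₁, c₂ ≠ 0`) has only the trivial solution
`d₂ = 0`, `c₂ = 1`, `c₁ = 1`. -/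
theorem stmt_14 (lam c₁ c₂ d₂ : ℝ) (hlam : 0 < lam) (hc₁ : c₁ ≠ 0) (hc₂ : c₂ ≠ 0)
    (h : ∀ y : ℝ,
      c₁ * Real.exp ((3 / 2) * lam * Real.arctan y) * (y ^ 2 + 1) ^ (-(3 : ℝ) / 4)
        = c₂ * Real.exp ((3 / 2) * lam * Real.arctan (c₂ * y + d₂))
            * ((c₂ * y + d₂) ^ 2 + 1) ^ (-(3 : ℝ) / 4)) :
    d₂ = 0 ∧ c₂ = 1 ∧ c₁ = 1 := by
  have key : ∀ y : ℝ, (lam - y) * ((c₂ * y + d₂) ^ 2 + 1)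
      = c₂ * (lam - (c₂ * y + d₂)) * (y ^ 2 + 1) := by
    intro y
    have hl := (aux_deriv (3 / 2 * lam) y).const_mul c₁
    have hu : HasDerivAt (fun y : ℝ => c₂ * y + d₂) c₂ y := by
      simpa using ((hasDerivAt_id y).const_mul c₂).add_const d₂
    have hr := ((aux_deriv (3 / 2 * lam) (c₂ * y + d₂)).comp y hu).const_mul c₂
    have hfun : (fun y : ℝ => c₁ * (Real.exp (3 / 2 * lam * Real.arctan y)
        * (y ^ 2 + 1) ^ (-(3 : ℝ) / 4))) = fun y : ℝ => c₂ *
        ((fun y : ℝ => Real.exp (3 / 2 * lam * Real.arctan y) * (y ^ 2 + 1) ^ (-(3 : ℝ) / 4)) ∘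
          (fun y : ℝ => c₂ * y + d₂)) y := by
      funext z
      have := h z
      simp only [Function.comp]
      linarith
    rw [hfun] at hl
    have e := hl.unique hr
    have hy := h y
    have hp : 0 < y ^ 2 + 1 := by positivity
    have hq : 0 < (c₂ * y + d₂) ^ 2 + 1 := by positivity
    have hF : c₁ * Real.exp ((3 / 2) * lam * Real.arctan y) * (y ^ 2 + 1) ^ (-(3 : ℝ) / 4) ≠ 0 :=
      mul_ne_zero (mul_ne_zero hc₁ (Real.exp_pos _).ne') (Real.rpow_pos_of_pos hp _).ne'
    have e2 : (3 / 2 * lam - 3 / 2 * y) / (y ^ 2 + 1)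
        = (3 / 2 * lam - 3 / 2 * (c₂ * y + d₂)) / ((c₂ * y + d₂) ^ 2 + 1) * c₂ := by
      apply mul_left_cancel₀ hF
      rw [← mul_assoc, ← mul_assoc] at e
      rw [e, hy]
      ring
    rw [div_mul_eq_mul_div (_ - _), div_eq_div_iff hp.ne' hq.ne'] at e2
    linarith
  have hfix : c₂ * lam + d₂ = lam := by
    have k := key lam
    have hp : lam ^ 2 + 1 ≠ 0 := by positivity
    have : c₂ * (lam - (c₂ * lam + d₂)) * (lam ^ 2 + 1) = 0 := by rw [← k]; ring
    simp only [mul_eq_zero, hc₂, hp, or_false, false_or] at this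
    linarith
  have hd : ∀ t : ℝ, t ≠ 0 → (c₂ * (lam + t) + d₂) ^ 2 + 1 = c₂ ^ 2 * ((lam + t) ^ 2 + 1) := by
    intro t ht
    have k := key (lam + t)
    apply mul_left_cancel₀ ht
    have e : lam - (c₂ * (lam + t) + d₂) = -(c₂ * t) := by linarith
    rw [e] at k
    linarith
  have hd0 : d₂ = 0 := by
    have k1 := hd 1 (by norm_num)
    have k2 := hd 2 (by norm_num)
    have : c₂ * d₂ = 0 := by linarith
    simpa [hc₂] using this
  have hc : c₂ = 1 := by
    apply mul_right_cancel₀ hlam.ne'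
    linarith
  refine ⟨hd0, hc, ?_⟩
  have := h 0
  simpa [hd0, hc] using this
end

section
/- Let c₁, c₂ ∈ ℝ∖{0} and d₂ ∈ ℝ. Suppose that for every y > 0 with c₂y + d₂ ≠ 0 one has c₁·e^{3/(2y)}·y^{−3/2} = c₂·e^{3/(2(c₂y + d₂))}·|c₂y + d₂|^{−3/2}. Then d₂ = 0, c₂ = 1 and c₁ = 1. -/
open Real

/-- The functional equation
`c₁ e^{3/(2y)} y^{−3/2} = c₂ e^{3/(2(c₂y+d₂))} |c₂y+d₂|^{−3/2}`
(for all `y > 0` with `c₂y + d₂ ≠ 0`, where `c₁, c₂ ≠ 0`) has only the trivial solution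
`d₂ = 0`, `c₂ = 1`, `c₁ = 1`. -/
theorem stmt_15 (c₁ c₂ d₂ : ℝ) (hc₁ : c₁ ≠ 0) (hc₂ : c₂ ≠ 0)
    (h : ∀ y : ℝ, 0 < y → c₂ * y + d₂ ≠ 0 →
      c₁ * Real.exp (3 / (2 * y)) * y ^ (-(3 : ℝ) / 2)
        = c₂ * Real.exp (3 / (2 * (c₂ * y + d₂))) * |c₂ * y + d₂| ^ (-(3 : ℝ) / 2)) :
    d₂ = 0 ∧ c₂ = 1 ∧ c₁ = 1 := by
  have hlog : ∀ y : ℝ, 0 < y → c₂ * y + d₂ ≠ 0 →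
      Real.log c₁ + 3 / 2 * y⁻¹ - 3 / 2 * Real.log y
        - (Real.log c₂ + 3 / 2 * (c₂ * y + d₂)⁻¹ - 3 / 2 * Real.log (c₂ * y + d₂)) = 0 := by
    intro y hy hu
    have hu' : 0 < |c₂ * y + d₂| := abs_pos.mpr hu
    have h1 := congrArg Real.log (h y hy hu)
    have p1 : y ^ (-(3 : ℝ) / 2) ≠ 0 := (Real.rpow_pos_of_pos hy _).ne'
    have p2 : |c₂ * y + d₂| ^ (-(3 : ℝ) / 2) ≠ 0 := (Real.rpow_pos_of_pos hu' _).ne'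
    rw [Real.log_mul (mul_ne_zero hc₁ (Real.exp_pos _).ne') p1,
      Real.log_mul (mul_ne_zero hc₂ (Real.exp_pos _).ne') p2,
      Real.log_mul hc₁ (Real.exp_pos _).ne', Real.log_mul hc₂ (Real.exp_pos _).ne',
      Real.log_exp, Real.log_exp, Real.log_rpow hy, Real.log_rpow hu', Real.log_abs] at h1
    have e1 : 3 / (2 * y) = 3 / 2 * y⁻¹ := by field_simp
    have e2 : 3 / (2 * (c₂ * y + d₂)) = 3 / 2 * (c₂ * y + d₂)⁻¹ := by field_simp
    rw [e1, e2] at h1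
    linarith
  have hpoly : ∀ y : ℝ, 0 < y → c₂ * y + d₂ ≠ 0 →
      (1 + y) * (c₂ * y + d₂) ^ 2 = c₂ * (1 + (c₂ * y + d₂)) * y ^ 2 := by
    intro y hy hu
    have hl : HasDerivAt (fun t : ℝ => c₂ * t + d₂) c₂ y := by
      simpa using ((hasDerivAt_id y).const_mul c₂).add_const d₂
    have hd := ((((hasDerivAt_inv hy.ne').const_mul (3 / 2 : ℝ)).const_add (Real.log c₁)).sub
      ((Real.hasDerivAt_log hy.ne').const_mul (3 / 2 : ℝ))).sub
      ((((hl.fun_inv hu).const_mul (3 / 2 : ℝ)).const_add (Real.log c₂)).sub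
      ((hl.log hu).const_mul (3 / 2 : ℝ)))
    have hc : ContinuousAt (fun t : ℝ => c₂ * t + d₂) y := hl.continuousAt
    have hz : HasDerivAt (fun _ : ℝ => (0 : ℝ)) 0 y := hasDerivAt_const y 0
    have hz' := hz.congr_of_eventuallyEq (f₁ := _) (by
      filter_upwards [lt_mem_nhds hy, hc.eventually_ne hu] with t ht hut
      exact hlog t ht hut)
    have := hd.unique hz'
    clear hd hz' hz hc hl
    generalize c₂ * y + d₂ = u at this hu ⊢
    field_simp at this
    linarith
  have habs : ∀ k : ℝ, 0 ≤ k → 0 < |d₂ / c₂| + 1 + k ∧ c₂ * (|d₂ / c₂| + 1 + k) + d₂ ≠ 0 := by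
    intro k hk
    refine ⟨by positivity, fun h0 => ?_⟩
    have : d₂ / c₂ = -(|d₂ / c₂| + 1 + k) := by
      rw [div_eq_iff hc₂]; linarith
    have := neg_abs_le (d₂ / c₂)
    linarith
  have q0 := hpoly _ (habs 0 le_rfl).1 (habs 0 le_rfl).2
  have q1 := hpoly _ (habs 1 (by norm_num)).1 (habs 1 (by norm_num)).2
  have q2 := hpoly _ (habs 2 (by norm_num)).1 (habs 2 (by norm_num)).2
  generalize |d₂ / c₂| = Y at q0 q1 q2
  have hA : c₂ ^ 2 + c₂ * d₂ - c₂ = 0 := by linear_combination (q0 - 2 * q1 + q2) / 2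
  have hB : d₂ ^ 2 + 2 * c₂ * d₂ = 0 := by
    linear_combination q1 - q0 - (2 * Y + 3) * hA
  have hC : d₂ ^ 2 = 0 := by
    linear_combination q0 - (Y + 1) ^ 2 * hA - (Y + 1) * hB
  have hd0 : d₂ = 0 := by simpa using hC
  subst hd0
  have hc1 : c₂ = 1 := by
    apply mul_left_cancel₀ hc₂
    linarith
  subst hc1
  refine ⟨rfl, rfl, ?_⟩
  have h1 := h 1 one_pos (by norm_num)
  simpa using h1
end

section
/- Let I, J ⊆ ℝ be open intervals, let X : I → ℝ and Y : J → ℝ be smooth functions, let ε ∈ {−1, 1}, and let U ⊆ I × J be an open set on which X(x) ≠ Y(y), X(x) ≠ 0 and Y(y) ≠ 0. Consider on U the two metrics g₁ = (X(x) − Y(y))·(dx² + ε·dy²) and g₂ = (1/X(x) − 1/Y(y))·( dx²/X(x) + ε·dy²/Y(y) ). Then g₁ and g₂ are projectively equivalent on U: their projective connections coincide, i.e. the four functions −Γ²₁₁, Γ¹₁₁ − 2Γ²₁₂, 2Γ¹₁₂ − Γ²₂₂, Γ¹₂₂ computed from the Christoffel symbols of g₁ equal the corresponding four functions computed from the Christoffel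 symbols of g₂, at every point of U. -/
open Real Matrix

/-- Matrix of the Liouville metric `g₁ = (X(x) − Y(y))(dx² + ε dy²)`. -/
noncomputable def g₁L (X Y : ℝ → ℝ) (ε : ℝ) (q : ℝ × ℝ) : Matrix (Fin 2) (Fin 2) ℝ :=
  !![X q.1 - Y q.2, 0; 0, ε * (X q.1 - Y q.2)]

/-- Matrix of the Liouville metric `g₂ = (1/X − 1/Y)(dx²/X + ε dy²/Y)`. -/
noncomputable def g₂L (X Y : ℝ → ℝ) (ε : ℝ) (q : ℝ × ℝ) : Matrix (Fin 2) (Fin 2) ℝ :=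
  !![(1 / X q.1 - 1 / Y q.2) / X q.1, 0; 0, ε * ((1 / X q.1 - 1 / Y q.2) / Y q.2)]

theorem aux_pd {f : ℝ × ℝ → ℝ} {p : ℝ × ℝ} {L : ℝ × ℝ →L[ℝ] ℝ} (h : HasFDerivAt f L p) :
    pd 0 f p = L (1, 0) ∧ pd 1 f p = L (0, 1) := by
  simp [pd, h.fderiv]

theorem aux_pd_zero (i : Fin 2) (p : ℝ × ℝ) : pd i (fun _ => (0 : ℝ)) p = 0 := by
  simp [pd]

theorem aux_inv (E G : ℝ) (hE : E ≠ 0) (hG : G ≠ 0) :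
    (!![E, 0; 0, G] : Matrix (Fin 2) (Fin 2) ℝ)⁻¹ = !![1 / E, 0; 0, 1 / G] := by
  apply Matrix.inv_eq_right_inv
  ext i j
  fin_cases i <;> fin_cases j <;> simp [Matrix.mul_apply, hE, hG]

theorem aux_chr (E G : ℝ × ℝ → ℝ) (p : ℝ × ℝ) (hE : E p ≠ 0) (hG : G p ≠ 0)
    (g : ℝ × ℝ → Matrix (Fin 2) (Fin 2) ℝ) (hg : g = fun q => !![E q, 0; 0, G q]) :
    christoffel g 1 0 0 p = - pd 1 E p / (2 * G p) ∧
    christoffel g 0 0 0 p = pd 0 E p / (2 * E p) ∧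
    christoffel g 1 0 1 p = pd 0 G p / (2 * G p) ∧
    christoffel g 0 0 1 p = pd 1 E p / (2 * E p) ∧
    christoffel g 1 1 1 p = pd 1 G p / (2 * G p) ∧
    christoffel g 0 1 1 p = - pd 0 G p / (2 * E p) := by
  subst hg
  refine ⟨?_, ?_, ?_, ?_, ?_, ?_⟩ <;>
    simp [christoffel, aux_inv _ _ hE hG, Fin.sum_univ_two, aux_pd_zero] <;> field_simp <;> ring

/-- The Liouville pair `g₁ = (X − Y)(dx² + ε dy²)` and
`g₂ = (1/X − 1/Y)(dx²/X + ε dy²/Y)` is projectively equivalent: the four coefficients of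
their projective connections coincide on `U`. -/
theorem stmt_16 (I J : Set ℝ) (hI : IsOpen I) (hI' : I.OrdConnected)
    (hJ : IsOpen J) (hJ' : J.OrdConnected)
    (X Y : ℝ → ℝ) (hX : ContDiffOn ℝ (⊤ : ℕ∞) X I) (hY : ContDiffOn ℝ (⊤ : ℕ∞) Y J)
    (ε : ℝ) (hε : ε = 1 ∨ ε = -1)
    (U : Set (ℝ × ℝ)) (hU : IsOpen U) (hUIJ : U ⊆ I ×ˢ J)
    (hne : ∀ p ∈ U, X p.1 ≠ Y p.2) (hX0 : ∀ p ∈ U, X p.1 ≠ 0)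
    (hY0 : ∀ p ∈ U, Y p.2 ≠ 0) :
    ∀ p ∈ U,
      -(christoffel (g₁L X Y ε) 1 0 0 p) = -(christoffel (g₂L X Y ε) 1 0 0 p) ∧
      christoffel (g₁L X Y ε) 0 0 0 p - 2 * christoffel (g₁L X Y ε) 1 0 1 p
        = christoffel (g₂L X Y ε) 0 0 0 p - 2 * christoffel (g₂L X Y ε) 1 0 1 p ∧
      2 * christoffel (g₁L X Y ε) 0 0 1 p - christoffel (g₁L X Y ε) 1 1 1 p
        = 2 * christoffel (g₂L X Y ε) 0 0 1 p - christoffel (g₂L X Y ε) 1 1 1 p ∧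
      christoffel (g₁L X Y ε) 0 1 1 p = christoffel (g₂L X Y ε) 0 1 1 p := by
  intro p hp
  obtain ⟨hpI, hpJ⟩ := hUIJ hp
  have n1 := hne p hp
  have n2 := hX0 p hp
  have n3 := hY0 p hp
  have hε0 : ε ≠ 0 := by rcases hε with h | h <;> simp [h]
  have n4 : X p.1 - Y p.2 ≠ 0 := sub_ne_zero.mpr n1
  have dX : HasDerivAt X (deriv X p.1) p.1 :=
    ((hX.contDiffAt (hI.mem_nhds hpI)).differentiableAt (by simp)).hasDerivAt
  have dY : HasDerivAt Y (deriv Y p.2) p.2 :=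
    ((hY.contDiffAt (hJ.mem_nhds hpJ)).differentiableAt (by simp)).hasDerivAt
  generalize deriv X p.1 = a at dX
  generalize deriv Y p.2 = b at dY
  have f1 : HasFDerivAt (fun q : ℝ × ℝ => q.1) (ContinuousLinearMap.fst ℝ ℝ ℝ) p := hasFDerivAt_fst
  have f2 : HasFDerivAt (fun q : ℝ × ℝ => q.2) (ContinuousLinearMap.snd ℝ ℝ ℝ) p := hasFDerivAt_snd
  have FX : HasFDerivAt (fun q : ℝ × ℝ => X q.1) _ p := dX.comp_hasFDerivAt p f1
  have FY : HasFDerivAt (fun q : ℝ × ℝ => Y q.2) _ p := dY.comp_hasFDerivAt p f2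
  have FU : HasFDerivAt (fun q : ℝ × ℝ => (X q.1)⁻¹) _ p := (dX.inv n2).comp_hasFDerivAt p f1
  have FV : HasFDerivAt (fun q : ℝ × ℝ => (Y q.2)⁻¹) _ p := (dY.inv n3).comp_hasFDerivAt p f2
  have n5 : (X p.1)⁻¹ - (Y p.2)⁻¹ ≠ 0 := sub_ne_zero.mpr (fun h => n1 (inv_injective h))
  obtain ⟨e1, e2⟩ := aux_pd (FX.fun_sub FY)
  obtain ⟨e3, e4⟩ := aux_pd ((FX.fun_sub FY).const_mul ε)
  obtain ⟨e5, e6⟩ := aux_pd ((FU.fun_sub FV).fun_mul FU)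
  obtain ⟨e7, e8⟩ := aux_pd (((FU.fun_sub FV).fun_mul FV).const_mul ε)
  obtain ⟨c1, c2, c3, c4, c5, c6⟩ := aux_chr (fun q => X q.1 - Y q.2)
    (fun q => ε * (X q.1 - Y q.2)) p n4 (mul_ne_zero hε0 n4) (g₁L X Y ε) rfl
  obtain ⟨d1, d2, d3, d4, d5, d6⟩ := aux_chr (fun q => ((X q.1)⁻¹ - (Y q.2)⁻¹) * (X q.1)⁻¹)
    (fun q => ε * (((X q.1)⁻¹ - (Y q.2)⁻¹) * (Y q.2)⁻¹)) p
    (mul_ne_zero n5 (inv_ne_zero n2)) (mul_ne_zero hε0 (mul_ne_zero n5 (inv_ne_zero n3)))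
    (g₂L X Y ε) (by funext q; simp [g₂L, div_eq_mul_inv])
  rw [c1, c2, c3, c4, c5, c6, d1, d2, d3, d4, d5, d6, e1, e2, e3, e4, e5, e6, e7, e8]
  have n6 : Y p.2 - X p.1 ≠ 0 := sub_ne_zero.mpr n1.symm
  have k : (X p.1)⁻¹ - (Y p.2)⁻¹ = (Y p.2 - X p.1) / (X p.1 * Y p.2) := by field_simp
  simp only [k]
  simp
  generalize X p.1 = x at *
  generalize Y p.2 = y at *
  obtain ⟨w, rfl⟩ : ∃ w, y = x + w := ⟨y - x, by ring⟩
  have n7 : w ≠ 0 := by simpa using n6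
  have k1 : x + w - x = w := by ring
  have k2 : x - (x + w) = -w := by ring
  simp only [k1, k2]
  refine ⟨?_, ?_, ?_, ?_⟩ <;> field_simp <;> ring
end

section
/- Let J ⊆ ℝ be an open interval, let Y : J → ℝ be a smooth function, and let U ⊆ ℝ × J be an open set on which 1 + x·Y'(y) ≠ 0 and Y(y) ≠ 0. Consider on U the two metrics g₁ = (1 + x·Y'(y))·dxdy and g₂ = ((1 + x·Y'(y))/Y(y)⁴)·( −2Y(y)·dxdy + (1 + x·Y'(y))·dy² ). Then g₁ and g₂ are projectively equivalent on U: the four functions −Γ²₁₁, Γ¹₁₁ − 2Γ²₁₂, 2Γ¹₁₂ − Γ²₂₂, Γ¹₂₂ computed from the Christoffel symbols of g₁ equal the corresponding four functions computed from the Christoffel symbols of g₂, at every point of U. -/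
open Real Matrix

/-- Matrix of the Jordan-block metric `g₁ = (1 + x Y'(y)) dxdy`. -/
noncomputable def g₁J (Y : ℝ → ℝ) (q : ℝ × ℝ) : Matrix (Fin 2) (Fin 2) ℝ :=
  !![0, (1 + q.1 * deriv Y q.2) / 2; (1 + q.1 * deriv Y q.2) / 2, 0]

/-- Matrix of the Jordan-block metric
`g₂ = ((1 + x Y'(y))/Y⁴)(−2Y dxdy + (1 + x Y'(y)) dy²)`. -/
noncomputable def g₂J (Y : ℝ → ℝ) (q : ℝ × ℝ) : Matrix (Fin 2) (Fin 2) ℝ :=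
  !![0, ((1 + q.1 * deriv Y q.2) / Y q.2 ^ 4) * (-(Y q.2));
     ((1 + q.1 * deriv Y q.2) / Y q.2 ^ 4) * (-(Y q.2)),
     ((1 + q.1 * deriv Y q.2) / Y q.2 ^ 4) * (1 + q.1 * deriv Y q.2)]

/-- The Jordan-block pair `g₁ = (1 + xY')dxdy` and
`g₂ = ((1 + xY')/Y⁴)(−2Y dxdy + (1 + xY')dy²)` is projectively equivalent: the four
coefficients of their projective connections coincide on `U`. -/
theorem stmt_17 (J : Set ℝ) (hJ : IsOpen J) (hJ' : J.OrdConnected)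
    (Y : ℝ → ℝ) (hY : ContDiffOn ℝ (⊤ : ℕ∞) Y J)
    (U : Set (ℝ × ℝ)) (hU : IsOpen U) (hUJ : U ⊆ Set.univ ×ˢ J)
    (hne : ∀ p ∈ U, 1 + p.1 * deriv Y p.2 ≠ 0)
    (hY0 : ∀ p ∈ U, Y p.2 ≠ 0) :
    ∀ p ∈ U,
      -(christoffel (g₁J Y) 1 0 0 p) = -(christoffel (g₂J Y) 1 0 0 p) ∧
      christoffel (g₁J Y) 0 0 0 p - 2 * christoffel (g₁J Y) 1 0 1 p
        = christoffel (g₂J Y) 0 0 0 p - 2 * christoffel (g₂J Y) 1 0 1 p ∧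
      2 * christoffel (g₁J Y) 0 0 1 p - christoffel (g₁J Y) 1 1 1 p
        = 2 * christoffel (g₂J Y) 0 0 1 p - christoffel (g₂J Y) 1 1 1 p ∧
      christoffel (g₁J Y) 0 1 1 p = christoffel (g₂J Y) 0 1 1 p := by
  intro p hp
  have hA := hne p hp
  have hy := hY0 p hp
  have hpJ : p.2 ∈ J := (hUJ hp).2
  have hYd : HasDerivAt Y (deriv Y p.2) p.2 :=
    ((hY.differentiableOn (by simp)).differentiableAt (hJ.mem_nhds hpJ)).hasDerivAt
  have hY' : ContDiffOn ℝ 1 (deriv Y) J := hY.deriv_of_isOpen hJ (by norm_cast)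
  have hYdd : HasDerivAt (deriv Y) (deriv (deriv Y) p.2) p.2 :=
    ((hY'.differentiableOn (by simp)).differentiableAt (hJ.mem_nhds hpJ)).hasDerivAt
  have hsnd : HasFDerivAt (fun q : ℝ × ℝ => q.2) (ContinuousLinearMap.snd ℝ ℝ ℝ) p := hasFDerivAt_snd
  have hfst : HasFDerivAt (fun q : ℝ × ℝ => q.1) (ContinuousLinearMap.fst ℝ ℝ ℝ) p := hasFDerivAt_fst
  have h1 := hYd.comp_hasFDerivAt p hsnd
  have h2 := hYdd.comp_hasFDerivAt p hsnd
  have h3 := ((hYd.pow 4).inv (pow_ne_zero 4 hy)).comp_hasFDerivAt p hsnd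
  have hAd := (hfst.mul h2).const_add 1
  have e1 := hAd.mul_const (2⁻¹ : ℝ)
  have e2 := (hAd.mul h3).mul h1.neg
  have e3 := (hAd.mul h3).mul hAd
  have f1 : ∀ i, pd i (fun q => (1 + q.1 * deriv Y q.2) / 2) p = _ := fun i =>
    congrArg (fun L => L (if i = 0 then ((1:ℝ), (0:ℝ)) else (0, 1))) e1.fderiv
  have f2 : ∀ i, pd i (fun q => ((1 + q.1 * deriv Y q.2) / Y q.2 ^ 4) * (-(Y q.2))) p = _ := fun i =>
    congrArg (fun L => L (if i = 0 then ((1:ℝ), (0:ℝ)) else (0, 1))) e2.fderiv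
  have f3 : ∀ i, pd i (fun q => ((1 + q.1 * deriv Y q.2) / Y q.2 ^ 4) * (1 + q.1 * deriv Y q.2)) p = _ :=
    fun i => congrArg (fun L => L (if i = 0 then ((1:ℝ), (0:ℝ)) else (0, 1))) e3.fderiv
  have f0 : ∀ i, pd i (fun _ => 0) p = 0 := fun i => by simp [pd]
  clear e1 e2 e3 hAd h1 h2 h3 hYd hYdd hsnd hfst hY'
  simp only [christoffel, Fin.sum_univ_two, g₁J, g₂J, Matrix.inv_def, Matrix.det_fin_two_of,
    Matrix.adjugate_fin_two_of, Ring.inverse_eq_inv', Matrix.smul_apply, Matrix.of_apply,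
    Matrix.cons_val', Matrix.cons_val_zero, Matrix.cons_val_one, Matrix.cons_val_fin_one, smul_eq_mul,
    f0, f1, f2, f3]
  simp
  generalize deriv (deriv Y) p.2 = c at *
  generalize hb : deriv Y p.2 = b at *
  generalize Y p.2 = a at *
  obtain ⟨x, y⟩ := p
  simp only at *
  obtain ⟨A, hAe⟩ : ∃ A, A = 1 + x * b := ⟨_, rfl⟩
  simp only [← hAe] at *
  refine ⟨?_, ?_, ?_⟩
  all_goals (field_simp; try ring)
end

section
/- Let w be the vector field w(x,y) = (2x, y) on ℝ², and let G₁, G₂, G₃ be the symmetric matrix fields of the metrics g₁ = (y² + x)·dxdy, g₂ = −2((y² + x)/y³)·dxdy + ((y² + x)²/y⁴)·dy², and g₃ = ((y² + x)/(3x − y²)⁶)·( 9(y² + x)·dx² − 4y(9x + y²)·dxdy + 12x(y² + x)·dy² ), defined respectively on {(x,y)}, {y ≠ 0}, and {3x − y² ≠ 0}. Then on the respective domains the Lie derivatives satisfy L_w g₁ = 5·g₁, L_w g₂ = 2·g₂, and L_w g₃ = −4·g₃; that is, w is a homothetic vector field for each of the three metrics, with homothety coefficients 5, 2 and −4. -/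
open Real Matrix

/-- The projective vector field `w = 2x ∂ₓ + y ∂ᵧ`. -/
def wProj (p : ℝ × ℝ) : ℝ × ℝ := (2 * p.1, p.2)

/-- Euler's identity for weighted homogeneous functions (weights 2 and 1). -/
theorem euler_aux (f : ℝ × ℝ → ℝ) (p : ℝ × ℝ) (n : ℤ) (hf : DifferentiableAt ℝ f p)
    (h : ∀ t : ℝ, 0 < t → f (t ^ 2 * p.1, t * p.2) = t ^ n * f p) :
    2 * p.1 * pd 0 f p + p.2 * pd 1 f p = n * f p := by
  have hc : HasDerivAt (fun t : ℝ => ((t ^ 2 * p.1, t * p.2) : ℝ × ℝ)) (2 * p.1, p.2) 1 := by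
    have h1 : HasDerivAt (fun t : ℝ => t ^ 2 * p.1) (2 * p.1) 1 := by
      simpa using (hasDerivAt_pow 2 (1 : ℝ)).mul_const p.1
    have h2 : HasDerivAt (fun t : ℝ => t * p.2) p.2 1 := by
      simpa using (hasDerivAt_id (1 : ℝ)).mul_const p.2
    exact h1.prodMk h2
  have hf' : HasFDerivAt f (fderiv ℝ f p) ((1 : ℝ) ^ 2 * p.1, (1 : ℝ) * p.2) := by
    simpa using hf.hasFDerivAt
  have hd := hf'.comp_hasDerivAt (1 : ℝ) hc
  have hz : HasDerivAt (fun t : ℝ => t ^ n * f p) (n * f p) 1 := by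
    simpa using (hasDerivAt_zpow n (1 : ℝ) (Or.inl one_ne_zero)).mul_const (f p)
  have he : (f ∘ fun t : ℝ => ((t ^ 2 * p.1, t * p.2) : ℝ × ℝ)) =ᶠ[nhds 1]
      fun t : ℝ => t ^ n * f p := by
    filter_upwards [lt_mem_nhds (zero_lt_one : (0 : ℝ) < 1)] with t ht
    exact h t ht
  have hu := hd.unique (hz.congr_of_eventuallyEq he)
  rw [← hu]
  have hv : ((2 * p.1, p.2) : ℝ × ℝ) = (2 * p.1) • ((1, 0) : ℝ × ℝ) + p.2 • ((0, 1) : ℝ × ℝ) := by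
    ext <;> simp
  rw [hv, map_add, map_smul, map_smul]
  simp [pd]

theorem pd_w (i k : Fin 2) (p : ℝ × ℝ) :
    pd i (wcomp wProj k) p = if i = k then (if k = 0 then 2 else 1) else 0 := by
  have h0 : wcomp wProj 0 = fun p : ℝ × ℝ => 2 * p.1 := by
    funext p; simp [wcomp, wProj]
  have h1 : wcomp wProj 1 = fun p : ℝ × ℝ => p.2 := by
    funext p; simp [wcomp, wProj]
  have d0 : HasFDerivAt (fun p : ℝ × ℝ => 2 * p.1)
      ((2 : ℝ) • ContinuousLinearMap.fst ℝ ℝ ℝ) p := hasFDerivAt_fst.const_mul 2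
  have d1 : HasFDerivAt (fun p : ℝ × ℝ => p.2) (ContinuousLinearMap.snd ℝ ℝ ℝ) p := hasFDerivAt_snd
  fin_cases k
  · simp only [Fin.zero_eta, h0, pd, d0.fderiv]
    fin_cases i <;> simp
  · simp only [Fin.mk_one, h1, pd, d1.fderiv]
    fin_cases i <;> simp

/-- The weight of the coordinate differential. -/
def wt (i : Fin 2) : ℤ := if i = 0 then 2 else 1

theorem lie_aux (g : ℝ × ℝ → Matrix (Fin 2) (Fin 2) ℝ) (p : ℝ × ℝ) (i j : Fin 2) (c : ℤ)
    (hf : DifferentiableAt ℝ (fun q => g q i j) p)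
    (h : ∀ t : ℝ, 0 < t → g (t ^ 2 * p.1, t * p.2) i j = t ^ (c - wt i - wt j) * g p i j) :
    lieD wProj g i j p = c * g p i j := by
  have he := euler_aux (fun q => g q i j) p _ hf h
  push_cast at he
  simp only [lieD, pd_w, Fin.sum_univ_two]
  have hw0 : wcomp wProj 0 p = 2 * p.1 := by simp [wcomp, wProj]
  have hw1 : wcomp wProj 1 p = p.2 := by simp [wcomp, wProj]
  rw [hw0, hw1, he]
  fin_cases i <;> fin_cases j <;> simp [wt] <;> ring

/-- The vector field `w = 2x∂ₓ + y∂ᵧ` is homothetic for each of the three generators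
`g₁, g₂, g₃` of the superintegrable projective class, with
`L_w g₁ = 5 g₁`, `L_w g₂ = 2 g₂` and `L_w g₃ = −4 g₃` on the respective domains. -/
theorem stmt_19 :
    (∀ p : ℝ × ℝ, ∀ i j : Fin 2, lieD wProj G₁ i j p = 5 * G₁ p i j) ∧
    (∀ p : ℝ × ℝ, p.2 ≠ 0 → ∀ i j : Fin 2, lieD wProj G₂ i j p = 2 * G₂ p i j) ∧
    (∀ p : ℝ × ℝ, 3 * p.1 - p.2 ^ 2 ≠ 0 → ∀ i j : Fin 2,
      lieD wProj G₃ i j p = -4 * G₃ p i j) := by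
  refine ⟨fun p i j => ?_, fun p hp i j => ?_, fun p hp i j => ?_⟩
  · refine (lie_aux G₁ p i j 5 ?_ fun t ht => ?_).trans (by norm_num)
    · fin_cases i <;> fin_cases j <;> simp [G₁] <;> fun_prop
    · fin_cases i <;> fin_cases j <;> simp [G₁, wt] <;> norm_num <;> ring
  · refine (lie_aux G₂ p i j 2 ?_ fun t ht => ?_).trans (by norm_num)
    · fin_cases i <;> fin_cases j <;> simp [G₂] <;> fun_prop (disch := positivity)
    · fin_cases i <;> fin_cases j <;> simp [G₂, wt] <;> norm_num <;> field_simp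
  · refine (lie_aux G₃ p i j (-4) ?_ fun t ht => ?_).trans (by norm_num)
    · have : (3 * p.1 - p.2 ^ 2) ^ 6 ≠ 0 := pow_ne_zero _ hp
      fin_cases i <;> fin_cases j <;> simp [G₃] <;> fun_prop (disch := assumption)
    · have e : 3 * (t ^ 2 * p.1) - (t * p.2) ^ 2 = t ^ 2 * (3 * p.1 - p.2 ^ 2) := by ring
      fin_cases i <;> fin_cases j <;> simp [G₃, wt, e] <;> norm_num <;>
        generalize 3 * p.1 - p.2 ^ 2 = D at * <;> field_simp
end
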